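/- arXiv:2604.02082 — 11 statements merged into one kernel-verified Lean document; each statement's English description precedes it below -/
import Mathlib

section
/- For every FS-algebra A, the assignments sending a modal filter F to the relation Θ(F) = {(a,b) : (a ⇨ b) ⊓ (b ⇨ a) ∈ F}, and sending an FS-congruence Θ to the set F(Θ) = {a : (a, ⊤) ∈ Θ}, are mutually inverse bijections between the set of modal filters on A and the set of FS-congruences on A. -/
/-- An FS-algebra: a Heyting algebra with operations □ and ◇ satisfying the
Fischer-Servi axioms. -/
structure FSAlg where
  carrier : Type
  [heyt : HeytingAlgebra carrier]
  box : carrier → carrier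
  dia : carrier → carrier
  box_top : box ⊤ = ⊤
  dia_bot : dia ⊥ = ⊥
  box_inf : ∀ a b : carrier, box (a ⊓ b) = box a ⊓ box b
  dia_sup : ∀ a b : carrier, dia (a ⊔ b) = dia a ⊔ dia b
  fs1 : ∀ a b : carrier, dia (a ⇨ b) ≤ box a ⇨ dia b
  fs2 : ∀ a b : carrier, (dia a ⇨ box b) ≤ box (a ⇨ b)

attribute [instance] FSAlg.heyt

/-- A modal filter on an FS-algebra: a (lattice) filter closed under □. -/
structure IsModalFilter (A : FSAlg) (F : Set A.carrier) : Prop where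
  top_mem : ⊤ ∈ F
  mem_of_le : ∀ a b : A.carrier, a ∈ F → a ≤ b → b ∈ F
  inf_mem : ∀ a b : A.carrier, a ∈ F → b ∈ F → a ⊓ b ∈ F
  box_mem : ∀ a : A.carrier, a ∈ F → A.box a ∈ F


/-- An FS-congruence: an equivalence relation compatible with all the Heyting
algebra operations and with □ and ◇. -/
structure IsFSCongr (A : FSAlg) (Θ : A.carrier → A.carrier → Prop) : Prop where
  refl : ∀ a, Θ a a
  symm : ∀ a b, Θ a b → Θ b a
  trans : ∀ a b c, Θ a b → Θ b c → Θ a c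
  inf : ∀ a b c d, Θ a b → Θ c d → Θ (a ⊓ c) (b ⊓ d)
  sup : ∀ a b c d, Θ a b → Θ c d → Θ (a ⊔ c) (b ⊔ d)
  himp : ∀ a b c d, Θ a b → Θ c d → Θ (a ⇨ c) (b ⇨ d)
  box : ∀ a b, Θ a b → Θ (A.box a) (A.box b)
  dia : ∀ a b, Θ a b → Θ (A.dia a) (A.dia b)

namespace FSAlg

variable (A : FSAlg) {a b : A.carrier}

theorem box_mono (h : a ≤ b) : A.box a ≤ A.box b := by
  rw [← inf_eq_left, ← A.box_inf, inf_eq_left.2 h]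

theorem dia_mono (h : a ≤ b) : A.dia a ≤ A.dia b := by
  rw [← sup_eq_right, ← A.dia_sup, sup_eq_right.2 h]

theorem box_himp_le (a b : A.carrier) : A.box (a ⇨ b) ≤ A.box a ⇨ A.box b := by
  rw [le_himp_iff, ← A.box_inf]
  exact A.box_mono himp_inf_le

theorem box_himp_le_dia_himp_dia (a b : A.carrier) :
    A.box (a ⇨ b) ≤ A.dia a ⇨ A.dia b := by
  rw [le_himp_comm]
  exact (A.dia_mono le_himp_himp).trans (A.fs1 _ _)

end FSAlg

namespace IsModalFilter

variable {A : FSAlg} {F : Set A.carrier}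

theorem inf_mem_iff (hF : IsModalFilter A F) {a b : A.carrier} :
    a ⊓ b ∈ F ↔ a ∈ F ∧ b ∈ F :=
  ⟨fun h => ⟨hF.mem_of_le _ _ h inf_le_left, hF.mem_of_le _ _ h inf_le_right⟩,
    fun h => hF.inf_mem _ _ h.1 h.2⟩

theorem mem_of_inf_le (hF : IsModalFilter A F) {a b c : A.carrier} (ha : a ∈ F) (hb : b ∈ F)
    (h : a ⊓ b ≤ c) : c ∈ F :=
  hF.mem_of_le _ _ (hF.inf_mem _ _ ha hb) h

theorem isFSCongr (hF : IsModalFilter A F) :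
    IsFSCongr A (fun a b => (a ⇨ b) ⊓ (b ⇨ a) ∈ F) := by
  have inf_himp (a b c d : A.carrier) : (a ⇨ b) ⊓ (c ⇨ d) ≤ a ⊓ c ⇨ b ⊓ d := by
    rw [le_himp_iff, inf_inf_inf_comm]
    exact inf_le_inf himp_inf_le himp_inf_le
  have sup_himp (a b c d : A.carrier) : (a ⇨ b) ⊓ (c ⇨ d) ≤ a ⊔ c ⇨ b ⊔ d := by
    rw [sup_himp_distrib]
    exact inf_le_inf (himp_le_himp_left le_sup_left) (himp_le_himp_left le_sup_right)
  have himp_himp (a b c d : A.carrier) : (b ⇨ a) ⊓ (c ⇨ d) ≤ (a ⇨ c) ⇨ (b ⇨ d) := by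
    rw [le_himp_iff, inf_right_comm]
    exact (inf_le_inf_right _ (himp_triangle _ _ _)).trans (himp_triangle _ _ _)
  simp only [hF.inf_mem_iff]
  refine ⟨fun a => ?_, fun a b h => h.symm, fun a b c h k => ?_, fun a b c d h k => ?_,
    fun a b c d h k => ?_, fun a b c d h k => ?_, fun a b h => ?_, fun a b h => ?_⟩
  · simpa using hF.top_mem
  · exact ⟨hF.mem_of_inf_le h.1 k.1 (himp_triangle _ _ _),
      hF.mem_of_inf_le k.2 h.2 (himp_triangle _ _ _)⟩
  · exact ⟨hF.mem_of_inf_le h.1 k.1 (inf_himp ..), hF.mem_of_inf_le h.2 k.2 (inf_himp ..)⟩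
  · exact ⟨hF.mem_of_inf_le h.1 k.1 (sup_himp ..), hF.mem_of_inf_le h.2 k.2 (sup_himp ..)⟩
  · exact ⟨hF.mem_of_inf_le h.2 k.1 (himp_himp ..), hF.mem_of_inf_le h.1 k.2 (himp_himp ..)⟩
  · exact ⟨hF.mem_of_le _ _ (hF.box_mem _ h.1) (A.box_himp_le _ _),
      hF.mem_of_le _ _ (hF.box_mem _ h.2) (A.box_himp_le _ _)⟩
  · exact ⟨hF.mem_of_le _ _ (hF.box_mem _ h.1) (A.box_himp_le_dia_himp_dia _ _),
      hF.mem_of_le _ _ (hF.box_mem _ h.2) (A.box_himp_le_dia_himp_dia _ _)⟩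

end IsModalFilter

namespace IsFSCongr

variable {A : FSAlg} {Θ : A.carrier → A.carrier → Prop}

theorem isModalFilter (hΘ : IsFSCongr A Θ) : IsModalFilter A {a | Θ a ⊤} where
  top_mem := hΘ.refl ⊤
  mem_of_le a b ha hab := by
    simpa [sup_eq_right.2 hab] using hΘ.sup a ⊤ b b ha (hΘ.refl b)
  inf_mem a b ha hb := by simpa using hΘ.inf a ⊤ b ⊤ ha hb
  box_mem a ha := by simpa [A.box_top] using hΘ.box a ⊤ ha

theorem rel_inf_of_himp (hΘ : IsFSCongr A Θ) {a b : A.carrier} (h : Θ (a ⇨ b) ⊤) :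
    Θ (a ⊓ b) a := by
  simpa using hΘ.inf a a (a ⇨ b) ⊤ (hΘ.refl a) h

theorem rel_iff (hΘ : IsFSCongr A Θ) (a b : A.carrier) :
    Θ a b ↔ Θ ((a ⇨ b) ⊓ (b ⇨ a)) ⊤ := by
  constructor
  · intro h
    simpa using hΘ.inf _ _ _ _ (hΘ.himp a b b b h (hΘ.refl b))
      (hΘ.himp b b a b (hΘ.refl b) h)
  · intro h
    obtain ⟨hab, hba⟩ := hΘ.isModalFilter.inf_mem_iff.1 h
    exact hΘ.trans _ _ _ (hΘ.symm _ _ (hΘ.rel_inf_of_himp hab))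
      (inf_comm b a ▸ hΘ.rel_inf_of_himp hba)

end IsFSCongr

/-- the assignments F ↦ Θ(F) and Θ ↦ F(Θ) are mutually inverse
bijections between modal filters and FS-congruences on any FS-algebra. -/
theorem modal_filters_biject_with_congruences (A : FSAlg) :
    (∀ F : Set A.carrier, IsModalFilter A F →
      IsFSCongr A (fun a b => (a ⇨ b) ⊓ (b ⇨ a) ∈ F)) ∧
    (∀ Θ : A.carrier → A.carrier → Prop, IsFSCongr A Θ →
      IsModalFilter A {a | Θ a ⊤}) ∧
    (∀ F : Set A.carrier, IsModalFilter A F →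
      {a | (a ⇨ (⊤ : A.carrier)) ⊓ ((⊤ : A.carrier) ⇨ a) ∈ F} = F) ∧
    (∀ Θ : A.carrier → A.carrier → Prop, IsFSCongr A Θ →
      ∀ a b, Θ a b ↔ (a ⇨ b) ⊓ (b ⇨ a) ∈ {x | Θ x ⊤}) := by
  refine ⟨fun F hF => hF.isFSCongr, fun Θ hΘ => hΘ.isModalFilter, fun F hF => ?_,
    fun Θ hΘ => hΘ.rel_iff⟩
  simp
end

section
/- Let L be a super-FS logic that has the Craig interpolation property. Then the class of FS_L-algebras has the amalgamation property: for all FS_L-algebras A, B₁, B₂ and injective FS-homomorphisms h₁ : A → B₁ and h₂ : A → B₂, there exist an FS_L-algebra C and injective FS-homomorphisms p₁ : B₁ → C and p₂ : B₂ → C with p₁ ∘ h₁ = p₂ ∘ h₂. -/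
/-- Formulas of the modal language L(□,◇). -/
inductive Fml : Type
  | var : ℕ → Fml
  | top : Fml
  | bot : Fml
  | and : Fml → Fml → Fml
  | or : Fml → Fml → Fml
  | imp : Fml → Fml → Fml
  | box : Fml → Fml
  | dia : Fml → Fml

/-- Uniform substitution. -/
def Fml.subst (σ : ℕ → Fml) : Fml → Fml
  | .var n => σ n
  | .top => .top
  | .bot => .bot
  | .and φ ψ => .and (φ.subst σ) (ψ.subst σ)
  | .or φ ψ => .or (φ.subst σ) (ψ.subst σ)
  | .imp φ ψ => .imp (φ.subst σ) (ψ.subst σ)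
  | .box φ => .box (φ.subst σ)
  | .dia φ => .dia (φ.subst σ)

/-- The set of propositional variables occurring in a formula. -/
def Fml.vars : Fml → Set ℕ
  | .var n => {n}
  | .top => ∅
  | .bot => ∅
  | .and φ ψ => φ.vars ∪ ψ.vars
  | .or φ ψ => φ.vars ∪ ψ.vars
  | .imp φ ψ => φ.vars ∪ ψ.vars
  | .box φ => φ.vars
  | .dia φ => φ.vars

/-- Theorems of the intuitionistic propositional calculus (in the modal
language), given by a standard Hilbert-style axiomatization; the axiom
schemes range over all formulas, so the set is closed under substitution. -/
inductive IPC : Fml → Prop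
  | ax1 (φ ψ : Fml) : IPC (φ.imp (ψ.imp φ))
  | ax2 (φ ψ χ : Fml) : IPC ((φ.imp (ψ.imp χ)).imp ((φ.imp ψ).imp (φ.imp χ)))
  | andE1 (φ ψ : Fml) : IPC ((φ.and ψ).imp φ)
  | andE2 (φ ψ : Fml) : IPC ((φ.and ψ).imp ψ)
  | andI (φ ψ : Fml) : IPC (φ.imp (ψ.imp (φ.and ψ)))
  | orI1 (φ ψ : Fml) : IPC (φ.imp (φ.or ψ))
  | orI2 (φ ψ : Fml) : IPC (ψ.imp (φ.or ψ))
  | orE (φ ψ χ : Fml) : IPC ((φ.imp χ).imp ((ψ.imp χ).imp ((φ.or ψ).imp χ)))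
  | botE (φ : Fml) : IPC (Fml.bot.imp φ)
  | topI : IPC Fml.top
  | mp (φ ψ : Fml) : IPC (φ.imp ψ) → IPC φ → IPC ψ

/-- A super-Fischer-Servi logic. -/
structure SuperFS (L : Set Fml) : Prop where
  ipc : ∀ φ : Fml, IPC φ → φ ∈ L
  axK : ∀ p q : Fml, ((p.imp q).box).imp ((p.box).imp (q.box)) ∈ L
  axKdia : ∀ p q : Fml, ((p.imp q).box).imp ((p.dia).imp (q.dia)) ∈ L
  axDiaOr : ∀ p q : Fml, ((p.or q).dia).imp ((p.dia).or (q.dia)) ∈ L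
  axFS : ∀ p q : Fml, (((p.dia).imp (q.box)).imp ((p.imp q).box)) ∈ L
  axDiaBot : (Fml.bot.dia).imp Fml.bot ∈ L
  subst : ∀ φ ∈ L, ∀ σ : ℕ → Fml, φ.subst σ ∈ L
  mp : ∀ φ ψ : Fml, φ.imp ψ ∈ L → φ ∈ L → ψ ∈ L
  nec : ∀ φ ∈ L, φ.box ∈ L

/-- The Craig interpolation property. -/
def CIP (L : Set Fml) : Prop :=
  ∀ φ ψ : Fml, φ.imp ψ ∈ L →
    ∃ χ : Fml, χ.vars ⊆ φ.vars ∩ ψ.vars ∧ φ.imp χ ∈ L ∧ χ.imp ψ ∈ L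


/-- Evaluation of a formula in an FS-algebra under an assignment. -/
def FSAlg.eval (A : FSAlg) (v : ℕ → A.carrier) : Fml → A.carrier
  | .var n => v n
  | .top => ⊤
  | .bot => ⊥
  | .and φ ψ => A.eval v φ ⊓ A.eval v ψ
  | .or φ ψ => A.eval v φ ⊔ A.eval v ψ
  | .imp φ ψ => A.eval v φ ⇨ A.eval v ψ
  | .box φ => A.box (A.eval v φ)
  | .dia φ => A.dia (A.eval v φ)

/-- A formula is valid in an FS-algebra if every assignment sends it to ⊤. -/
def FSAlg.Valid (A : FSAlg) (φ : Fml) : Prop := ∀ v : ℕ → A.carrier, A.eval v φ = ⊤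

/-- An FS_L-algebra: an FS-algebra validating every formula of L. -/
def IsFSLAlg (L : Set Fml) (A : FSAlg) : Prop := ∀ φ ∈ L, A.Valid φ

/-- An FS-homomorphism: a Heyting algebra homomorphism preserving □ and ◇. -/
structure IsFSHom (A B : FSAlg) (h : A.carrier → B.carrier) : Prop where
  map_top : h ⊤ = ⊤
  map_bot : h ⊥ = ⊥
  map_inf : ∀ a b, h (a ⊓ b) = h a ⊓ h b
  map_sup : ∀ a b, h (a ⊔ b) = h a ⊔ h b
  map_himp : ∀ a b, h (a ⇨ b) = h a ⇨ h b
  map_box : ∀ a, h (A.box a) = B.box (h a)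
  map_dia : ∀ a, h (A.dia a) = B.dia (h a)

/-- Formulas of the modal language over an arbitrary type of variables. -/
inductive Form (V : Type) : Type
  | var : V → Form V
  | top : Form V
  | bot : Form V
  | and : Form V → Form V → Form V
  | or : Form V → Form V → Form V
  | imp : Form V → Form V → Form V
  | box : Form V → Form V
  | dia : Form V → Form V

/-- Substitution of formulas over `V` for the variables of a formula. -/
def Fml.inst {V : Type} (τ : ℕ → Form V) : Fml → Form V
  | .var n => τ n
  | .top => .top
  | .bot => .bot
  | .and φ ψ => .and (φ.inst τ) (ψ.inst τ)
  | .or φ ψ => .or (φ.inst τ) (ψ.inst τ)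
  | .imp φ ψ => .imp (φ.inst τ) (ψ.inst τ)
  | .box φ => .box (φ.inst τ)
  | .dia φ => .dia (φ.inst τ)

namespace Form

variable {V : Type}

/-- Substitution of formulas for the variables of a formula over `V`. -/
def toFml (σ : V → Fml) : Form V → Fml
  | var x => σ x
  | top => .top
  | bot => .bot
  | and φ ψ => .and (φ.toFml σ) (ψ.toFml σ)
  | or φ ψ => .or (φ.toFml σ) (ψ.toFml σ)
  | imp φ ψ => .imp (φ.toFml σ) (ψ.toFml σ)
  | box φ => .box (φ.toFml σ)
  | dia φ => .dia (φ.toFml σ)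

/-- The set of variables occurring in a formula over `V`. -/
def vars : Form V → Set V
  | var x => {x}
  | top => ∅
  | bot => ∅
  | and φ ψ => φ.vars ∪ ψ.vars
  | or φ ψ => φ.vars ∪ ψ.vars
  | imp φ ψ => φ.vars ∪ ψ.vars
  | box φ => φ.vars
  | dia φ => φ.vars

/-- Evaluation of a formula over `V` in an FS-algebra. -/
def eval (D : FSAlg) (v : V → D.carrier) : Form V → D.carrier
  | var x => v x
  | top => ⊤
  | bot => ⊥
  | and φ ψ => φ.eval D v ⊓ ψ.eval D v
  | or φ ψ => φ.eval D v ⊔ ψ.eval D v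
  | imp φ ψ => φ.eval D v ⇨ ψ.eval D v
  | box φ => D.box (φ.eval D v)
  | dia φ => D.dia (φ.eval D v)

theorem finite_vars (φ : Form V) : φ.vars.Finite := by
  induction φ <;> simp_all [vars]

theorem toFml_inst (τ : ℕ → Form V) (σ : V → Fml) (φ : Fml) :
    (φ.inst τ).toFml σ = φ.subst fun n => (τ n).toFml σ := by
  induction φ <;> simp_all [toFml, Fml.inst, Fml.subst]

theorem subst_toFml (σ : V → Fml) (τ : ℕ → Fml) (φ : Form V) :
    (φ.toFml σ).subst τ = φ.toFml fun x => (σ x).subst τ := by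
  induction φ <;> simp_all [toFml, Fml.subst]

theorem toFml_congr {σ σ' : V → Fml} {φ : Form V} (h : ∀ x ∈ φ.vars, σ x = σ' x) :
    φ.toFml σ = φ.toFml σ' := by
  induction φ <;> simp_all [toFml, vars]

theorem vars_toFml_var (f : V → ℕ) (φ : Form V) :
    (φ.toFml fun x => .var (f x)).vars = f '' φ.vars := by
  induction φ <;> simp_all [toFml, vars, Fml.vars, Set.image_union]

theorem vars_inst_var (g : ℕ → V) (φ : Fml) :
    (φ.inst fun n => var (g n)).vars = g '' φ.vars := by
  induction φ <;> simp_all [Fml.inst, vars, Fml.vars, Set.image_union]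

theorem eval_toFml (D : FSAlg) (w : ℕ → D.carrier) (σ : V → Fml) (φ : Form V) :
    D.eval w (φ.toFml σ) = φ.eval D fun x => D.eval w (σ x) := by
  induction φ <;> simp_all [toFml, eval, FSAlg.eval]

theorem eval_congr {D : FSAlg} {v v' : V → D.carrier} {φ : Form V}
    (h : ∀ x ∈ φ.vars, v x = v' x) : φ.eval D v = φ.eval D v' := by
  induction φ <;> simp_all [eval, vars]

theorem eval_hom {A D : FSAlg} {h : A.carrier → D.carrier} (hh : IsFSHom A D h)
    (u : V → A.carrier) (φ : Form V) : φ.eval D (fun x => h (u x)) = h (φ.eval A u) := by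
  induction φ <;> simp_all [eval, hh.map_top, hh.map_bot, hh.map_inf, hh.map_sup, hh.map_himp,
    hh.map_box, hh.map_dia]

/-- A finite set of variables can be renamed to natural numbers and back. -/
theorem exists_rename [Nonempty V] {s : Set V} (hs : s.Finite) :
    ∃ (f : V → ℕ) (g : ℕ → V), ∀ x ∈ s, g (f x) = x := by
  obtain ⟨f, hf⟩ := Set.countable_iff_exists_injOn.1 hs.countable
  exact ⟨f, Function.invFunOn f s, fun _ hx => hf.leftInvOn_invFunOn hx⟩

/-- Sets of formulas over `V` that contain the axioms of Fischer-Servi logic and are closed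
under modus ponens and necessitation. -/
structure IsTheory (T : Set (Form V)) : Prop where
  ax1 (φ ψ : Form V) : φ.imp (ψ.imp φ) ∈ T
  ax2 (φ ψ χ : Form V) : (φ.imp (ψ.imp χ)).imp ((φ.imp ψ).imp (φ.imp χ)) ∈ T
  andE1 (φ ψ : Form V) : (φ.and ψ).imp φ ∈ T
  andE2 (φ ψ : Form V) : (φ.and ψ).imp ψ ∈ T
  andI (φ ψ : Form V) : φ.imp (ψ.imp (φ.and ψ)) ∈ T
  orI1 (φ ψ : Form V) : φ.imp (φ.or ψ) ∈ T
  orI2 (φ ψ : Form V) : ψ.imp (φ.or ψ) ∈ T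
  orE (φ ψ χ : Form V) : (φ.imp χ).imp ((ψ.imp χ).imp ((φ.or ψ).imp χ)) ∈ T
  botE (φ : Form V) : bot.imp φ ∈ T
  topI : top ∈ T
  axK (φ ψ : Form V) : (φ.imp ψ).box.imp (φ.box.imp ψ.box) ∈ T
  axKdia (φ ψ : Form V) : (φ.imp ψ).box.imp (φ.dia.imp ψ.dia) ∈ T
  axDiaOr (φ ψ : Form V) : (φ.or ψ).dia.imp (φ.dia.or ψ.dia) ∈ T
  axFS (φ ψ : Form V) : (φ.dia.imp ψ.box).imp (φ.imp ψ).box ∈ T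
  axDiaBot : (bot.dia : Form V).imp bot ∈ T
  mp {φ ψ : Form V} : φ.imp ψ ∈ T → φ ∈ T → ψ ∈ T
  nec {φ : Form V} : φ ∈ T → φ.box ∈ T

namespace IsTheory

variable {T : Set (Form V)}

theorem weaken (hT : IsTheory T) {φ : Form V} (ψ : Form V) (h : φ ∈ T) : ψ.imp φ ∈ T :=
  hT.mp (hT.ax1 φ ψ) h

theorem imp_mp (hT : IsTheory T) {φ ψ χ : Form V} (h : φ.imp (ψ.imp χ) ∈ T)
    (h' : φ.imp ψ ∈ T) : φ.imp χ ∈ T :=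
  hT.mp (hT.mp (hT.ax2 φ ψ χ) h) h'

theorem imp_refl (hT : IsTheory T) (φ : Form V) : φ.imp φ ∈ T :=
  hT.imp_mp (hT.ax1 φ (φ.imp φ)) (hT.ax1 φ φ)

theorem imp_trans (hT : IsTheory T) {φ ψ χ : Form V} (h : φ.imp ψ ∈ T) (h' : ψ.imp χ ∈ T) :
    φ.imp χ ∈ T :=
  hT.imp_mp (hT.weaken φ h') h

theorem imp_and (hT : IsTheory T) {φ ψ χ : Form V} (h : φ.imp ψ ∈ T) (h' : φ.imp χ ∈ T) :
    φ.imp (ψ.and χ) ∈ T :=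
  hT.imp_mp (hT.imp_trans h (hT.andI ψ χ)) h'

theorem or_imp (hT : IsTheory T) {φ ψ χ : Form V} (h : φ.imp χ ∈ T) (h' : ψ.imp χ ∈ T) :
    (φ.or ψ).imp χ ∈ T :=
  hT.mp (hT.mp (hT.orE φ ψ χ) h) h'

theorem imp_imp_iff (hT : IsTheory T) {φ ψ χ : Form V} :
    φ.imp (ψ.imp χ) ∈ T ↔ (φ.and ψ).imp χ ∈ T :=
  ⟨fun h => hT.imp_mp (hT.imp_trans (hT.andE1 φ ψ) h) (hT.andE2 φ ψ),
    fun h => hT.imp_trans (hT.andI φ ψ) (hT.mp (hT.ax2 ψ (φ.and ψ) χ) (hT.weaken ψ h))⟩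

theorem imp_imp_imp (hT : IsTheory T) {φ φ' ψ ψ' : Form V} (h : φ'.imp φ ∈ T)
    (h' : ψ.imp ψ' ∈ T) : (φ.imp ψ).imp (φ'.imp ψ') ∈ T :=
  hT.imp_imp_iff.2 <| hT.imp_trans
    (hT.imp_mp (hT.andE1 _ _) (hT.imp_trans (hT.andE2 _ _) h)) h'

theorem box_imp_box (hT : IsTheory T) {φ ψ : Form V} (h : φ.imp ψ ∈ T) : φ.box.imp ψ.box ∈ T :=
  hT.mp (hT.axK φ ψ) (hT.nec h)

theorem dia_imp_dia (hT : IsTheory T) {φ ψ : Form V} (h : φ.imp ψ ∈ T) : φ.dia.imp ψ.dia ∈ T :=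
  hT.mp (hT.axKdia φ ψ) (hT.nec h)

/-- Provable equivalence. -/
def setoid (hT : IsTheory T) : Setoid (Form V) where
  r φ ψ := φ.imp ψ ∈ T ∧ ψ.imp φ ∈ T
  iseqv :=
    ⟨fun φ => ⟨hT.imp_refl φ, hT.imp_refl φ⟩, And.symm,
      fun h h' => ⟨hT.imp_trans h.1 h'.1, hT.imp_trans h'.2 h.2⟩⟩

/-- Formulas up to provable equivalence. -/
def Lind (hT : IsTheory T) : Type := Quotient hT.setoid

/-- The class of a formula up to provable equivalence. -/
def cls (hT : IsTheory T) (φ : Form V) : hT.Lind := Quotient.mk hT.setoid φ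

theorem cls_surjective (hT : IsTheory T) : Function.Surjective hT.cls := Quotient.mk_surjective

instance (hT : IsTheory T) : LE hT.Lind where
  le := Quotient.lift₂ (fun φ ψ => φ.imp ψ ∈ T) fun _ _ _ _ h h' =>
    propext ⟨fun k => hT.imp_trans (hT.imp_trans h.2 k) h'.1,
      fun k => hT.imp_trans (hT.imp_trans h.1 k) h'.2⟩

theorem cls_le_cls {hT : IsTheory T} {φ ψ : Form V} : hT.cls φ ≤ hT.cls ψ ↔ φ.imp ψ ∈ T := Iff.rfl

instance (hT : IsTheory T) : HeytingAlgebra hT.Lind where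
  le_refl := hT.cls_surjective.forall.2 hT.imp_refl
  le_trans := hT.cls_surjective.forall₃.2 fun _ _ _ => hT.imp_trans
  le_antisymm := hT.cls_surjective.forall₂.2 fun _ _ h h' => Quotient.sound ⟨h, h'⟩
  inf := Quotient.map₂ and fun _ _ h _ _ h' =>
    ⟨hT.imp_and (hT.imp_trans (hT.andE1 _ _) h.1) (hT.imp_trans (hT.andE2 _ _) h'.1),
      hT.imp_and (hT.imp_trans (hT.andE1 _ _) h.2) (hT.imp_trans (hT.andE2 _ _) h'.2)⟩
  sup := Quotient.map₂ or fun _ _ h _ _ h' =>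
    ⟨hT.or_imp (hT.imp_trans h.1 (hT.orI1 _ _)) (hT.imp_trans h'.1 (hT.orI2 _ _)),
      hT.or_imp (hT.imp_trans h.2 (hT.orI1 _ _)) (hT.imp_trans h'.2 (hT.orI2 _ _))⟩
  himp := Quotient.map₂ imp fun _ _ h _ _ h' =>
    ⟨hT.imp_imp_imp h.2 h'.1, hT.imp_imp_imp h.1 h'.2⟩
  top := hT.cls top
  bot := hT.cls bot
  compl := Quotient.map (fun φ => φ.imp bot) fun _ _ h =>
    ⟨hT.imp_imp_imp h.2 (hT.imp_refl _), hT.imp_imp_imp h.1 (hT.imp_refl _)⟩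
  le_top := hT.cls_surjective.forall.2 fun φ => hT.weaken φ hT.topI
  bot_le := hT.cls_surjective.forall.2 hT.botE
  inf_le_left := hT.cls_surjective.forall₂.2 hT.andE1
  inf_le_right := hT.cls_surjective.forall₂.2 hT.andE2
  le_inf := hT.cls_surjective.forall₃.2 fun _ _ _ => hT.imp_and
  le_sup_left := hT.cls_surjective.forall₂.2 hT.orI1
  le_sup_right := hT.cls_surjective.forall₂.2 hT.orI2
  sup_le := hT.cls_surjective.forall₃.2 fun _ _ _ => hT.or_imp
  le_himp_iff := hT.cls_surjective.forall₃.2 fun _ _ _ => hT.imp_imp_iff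
  himp_bot := hT.cls_surjective.forall.2 fun _ => rfl

theorem cls_eq_top {hT : IsTheory T} {φ : Form V} : hT.cls φ = ⊤ ↔ φ ∈ T :=
  top_le_iff.symm.trans ⟨fun h => hT.mp h hT.topI, fun h => hT.weaken top h⟩

/-- The necessity operator on formulas up to provable equivalence. -/
def lindBox (hT : IsTheory T) : hT.Lind → hT.Lind :=
  Quotient.map box fun _ _ h => ⟨hT.box_imp_box h.1, hT.box_imp_box h.2⟩

/-- The possibility operator on formulas up to provable equivalence. -/
def lindDia (hT : IsTheory T) : hT.Lind → hT.Lind :=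
  Quotient.map dia fun _ _ h => ⟨hT.dia_imp_dia h.1, hT.dia_imp_dia h.2⟩

theorem lindBox_mono (hT : IsTheory T) : Monotone hT.lindBox :=
  hT.cls_surjective.forall₂.2 fun _ _ => hT.box_imp_box

theorem lindDia_mono (hT : IsTheory T) : Monotone hT.lindDia :=
  hT.cls_surjective.forall₂.2 fun _ _ => hT.dia_imp_dia

theorem lindBox_himp_le (hT : IsTheory T) :
    ∀ a b, hT.lindBox (a ⇨ b) ≤ hT.lindBox a ⇨ hT.lindBox b :=
  hT.cls_surjective.forall₂.2 hT.axK

theorem lindBox_himp_le_dia (hT : IsTheory T) :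
    ∀ a b, hT.lindBox (a ⇨ b) ≤ hT.lindDia a ⇨ hT.lindDia b :=
  hT.cls_surjective.forall₂.2 hT.axKdia

theorem lindDia_sup_le (hT : IsTheory T) :
    ∀ a b, hT.lindDia (a ⊔ b) ≤ hT.lindDia a ⊔ hT.lindDia b :=
  hT.cls_surjective.forall₂.2 hT.axDiaOr

/-- The Lindenbaum algebra of a theory. -/
def lindenbaum (hT : IsTheory T) : FSAlg where
  carrier := hT.Lind
  box := hT.lindBox
  dia := hT.lindDia
  box_top := cls_eq_top.2 (hT.nec hT.topI)
  dia_bot := le_bot_iff.1 hT.axDiaBot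
  box_inf a b := by
    refine le_antisymm (hT.lindBox_mono.map_inf_le a b) (le_himp_iff.1 ?_)
    exact (hT.lindBox_mono (le_himp_iff.2 le_rfl)).trans (hT.lindBox_himp_le b (a ⊓ b))
  dia_sup a b := le_antisymm (hT.lindDia_sup_le a b)
    (hT.lindDia_mono.le_map_sup a b)
  fs1 a b := le_himp_comm.1 <|
    (hT.lindBox_mono (le_himp_iff.2 inf_himp_le)).trans (hT.lindBox_himp_le_dia (a ⇨ b) b)
  fs2 := hT.cls_surjective.forall₂.2 hT.axFS

theorem eval_lindenbaum_cls (hT : IsTheory T) (τ : ℕ → Form V) (φ : Fml) :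
    hT.lindenbaum.eval (fun n => hT.cls (τ n)) φ = hT.cls (φ.inst τ) := by
  induction φ with
  | var | top | bot => rfl
  | and _ _ h h' | or _ _ h h' | imp _ _ h h' => simp only [FSAlg.eval, h, h']; rfl
  | box _ h | dia _ h => simp only [FSAlg.eval, h]; rfl

end IsTheory

/-- The formulas over `V` all of whose substitution instances belong to `L`. -/
def logic (V : Type) (L : Set Fml) : Set (Form V) := {φ | ∀ σ : V → Fml, φ.toFml σ ∈ L}

variable {L : Set Fml}

theorem isTheory_logic (V : Type) (hL : SuperFS L) : IsTheory (logic V L) where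
  ax1 _ _ _ := hL.ipc _ (.ax1 _ _)
  ax2 _ _ _ _ := hL.ipc _ (.ax2 _ _ _)
  andE1 _ _ _ := hL.ipc _ (.andE1 _ _)
  andE2 _ _ _ := hL.ipc _ (.andE2 _ _)
  andI _ _ _ := hL.ipc _ (.andI _ _)
  orI1 _ _ _ := hL.ipc _ (.orI1 _ _)
  orI2 _ _ _ := hL.ipc _ (.orI2 _ _)
  orE _ _ _ _ := hL.ipc _ (.orE _ _ _)
  botE _ _ := hL.ipc _ (.botE _)
  topI _ := hL.ipc _ .topI
  axK _ _ _ := hL.axK _ _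
  axKdia _ _ _ := hL.axKdia _ _
  axDiaOr _ _ _ := hL.axDiaOr _ _
  axFS _ _ _ := hL.axFS _ _
  axDiaBot _ := hL.axDiaBot
  mp h h' σ := hL.mp _ _ (h σ) (h' σ)
  nec h σ := hL.nec _ (h σ)

theorem inst_mem_logic (hL : SuperFS L) {φ : Fml} (hφ : φ ∈ L) (τ : ℕ → Form V) :
    φ.inst τ ∈ logic V L := fun σ => by
  rw [toFml_inst]
  exact hL.subst φ hφ _

theorem isFSLAlg_lindenbaum (hL : SuperFS L) {T : Set (Form V)} (hT : IsTheory T)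
    (h : logic V L ⊆ T) : IsFSLAlg L hT.lindenbaum := by
  intro φ hφ v
  choose τ hτ using fun n => hT.cls_surjective (v n)
  rw [← funext hτ, hT.eval_lindenbaum_cls]
  exact IsTheory.cls_eq_top.2 (h (inst_mem_logic hL hφ τ))

theorem eval_eq_top_of_mem_logic [Nonempty V] {D : FSAlg} (hD : IsFSLAlg L D) {φ : Form V}
    (hφ : φ ∈ logic V L) (v : V → D.carrier) : φ.eval D v = ⊤ := by
  obtain ⟨f, g, hg⟩ := exists_rename φ.finite_vars
  rw [← hD _ (hφ fun x => .var (f x)) fun n => v (g n), eval_toFml]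
  exact eval_congr fun x hx => by simp [FSAlg.eval, hg x hx]

theorem interpolation [Nonempty V] (hL : SuperFS L) (hCIP : CIP L) {φ ψ : Form V}
    (h : φ.imp ψ ∈ logic V L) :
    ∃ χ : Form V, χ.vars ⊆ φ.vars ∩ ψ.vars ∧ φ.imp χ ∈ logic V L ∧ χ.imp ψ ∈ logic V L := by
  obtain ⟨f, g, hg⟩ := exists_rename (φ.finite_vars.union ψ.finite_vars)
  obtain ⟨χ, hχ, h₁, h₂⟩ := hCIP _ _ (h fun x => .var (f x))
  have key (θ : Form V) (hθ : θ.vars ⊆ φ.vars ∪ ψ.vars) (σ : V → Fml) :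
      (θ.toFml fun x => .var (f x)).subst (fun n => σ (g n)) = θ.toFml σ := by
    rw [subst_toFml]
    exact toFml_congr fun x hx => by simp [Fml.subst, hg x (hθ hx)]
  refine ⟨χ.inst fun n => var (g n), ?_, fun σ => ?_, fun σ => ?_⟩
  · rw [vars_inst_var]
    rintro _ ⟨n, hn, rfl⟩
    have hn := hχ hn
    rw [vars_toFml_var, vars_toFml_var] at hn
    obtain ⟨⟨x, hx, rfl⟩, y, hy, hxy⟩ := hn
    have : x = y := by rw [← hg x (.inl hx), ← hg y (.inr hy), hxy]
    rw [hg x (.inl hx)]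
    exact ⟨hx, this ▸ hy⟩
  · have := hL.subst _ h₁ fun n => σ (g n)
    simp only [Fml.subst] at this
    rw [key φ Set.subset_union_left] at this
    simpa only [toFml, toFml_inst] using this
  · have := hL.subst _ h₂ fun n => σ (g n)
    simp only [Fml.subst] at this
    rw [key ψ Set.subset_union_right] at this
    simpa only [toFml, toFml_inst] using this

/-- The formulas with variables in `S` that are true in `D` under the assignment `v`. -/
def diagram (D : FSAlg) (v : V → D.carrier) (S : Set V) : Set (Form V) :=
  {φ | φ.vars ⊆ S ∧ φ.eval D v = ⊤}

theorem top_mem_diagram (D : FSAlg) (v : V → D.carrier) (S : Set V) : top ∈ diagram D v S :=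
  ⟨Set.empty_subset S, rfl⟩

theorem and_mem_diagram {D : FSAlg} {v : V → D.carrier} {S : Set V} {φ ψ : Form V}
    (hφ : φ ∈ diagram D v S) (hψ : ψ ∈ diagram D v S) : φ.and ψ ∈ diagram D v S :=
  ⟨Set.union_subset hφ.1 hψ.1, by simp [eval, hφ.2, hψ.2]⟩

theorem box_mem_diagram {D : FSAlg} {v : V → D.carrier} {S : Set V} {φ : Form V}
    (hφ : φ ∈ diagram D v S) : φ.box ∈ diagram D v S :=
  ⟨hφ.1, by simp [eval, hφ.2, D.box_top]⟩

theorem imp_mem_diagram {D : FSAlg} {v : V → D.carrier} {S : Set V} {φ ψ : Form V}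
    (hφ : φ.vars ⊆ S) (hψ : ψ.vars ⊆ S) (h : φ.eval D v ≤ ψ.eval D v) :
    φ.imp ψ ∈ diagram D v S :=
  ⟨Set.union_subset hφ hψ, himp_eq_top_iff.2 h⟩

/-- The consequences over `L` of the union of two sets closed under conjunction. -/
def join (L : Set Fml) (T₁ T₂ : Set (Form V)) : Set (Form V) :=
  {φ | ∃ γ₁ ∈ T₁, ∃ γ₂ ∈ T₂, γ₁.imp (γ₂.imp φ) ∈ logic V L}

theorem join_comm (hL : SuperFS L) (T₁ T₂ : Set (Form V)) : join L T₁ T₂ ⊆ join L T₂ T₁ := by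
  rintro φ ⟨γ₁, h₁, γ₂, h₂, h⟩
  refine ⟨γ₂, h₂, γ₁, h₁, ?_⟩
  have hT := isTheory_logic V hL
  exact le_himp_comm.1 (show hT.cls γ₁ ≤ hT.cls γ₂ ⇨ hT.cls φ from h)

section Diagrams

variable {D₁ D₂ : FSAlg} {v₁ : V → D₁.carrier} {v₂ : V → D₂.carrier} {S₁ S₂ : Set V}

theorem logic_subset_join (hL : SuperFS L) :
    logic V L ⊆ join L (diagram D₁ v₁ S₁) (diagram D₂ v₂ S₂) := fun _ hφ =>
  have hT := isTheory_logic V hL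
  ⟨top, top_mem_diagram _ _ _, top, top_mem_diagram _ _ _, hT.weaken _ (hT.weaken _ hφ)⟩

theorem diagram_subset_join (hL : SuperFS L) :
    diagram D₁ v₁ S₁ ⊆ join L (diagram D₁ v₁ S₁) (diagram D₂ v₂ S₂) := fun φ hφ =>
  ⟨φ, hφ, top, top_mem_diagram _ _ _, (isTheory_logic V hL).ax1 _ _⟩

theorem isTheory_join (hL : SuperFS L) :
    IsTheory (join L (diagram D₁ v₁ S₁) (diagram D₂ v₂ S₂)) :=
  have hT := isTheory_logic V hL
  have sub := logic_subset_join (v₁ := v₁) (v₂ := v₂) (S₁ := S₁) (S₂ := S₂) hL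
  { ax1 _ _ := sub (hT.ax1 _ _)
    ax2 _ _ _ := sub (hT.ax2 _ _ _)
    andE1 _ _ := sub (hT.andE1 _ _)
    andE2 _ _ := sub (hT.andE2 _ _)
    andI _ _ := sub (hT.andI _ _)
    orI1 _ _ := sub (hT.orI1 _ _)
    orI2 _ _ := sub (hT.orI2 _ _)
    orE _ _ _ := sub (hT.orE _ _ _)
    botE _ := sub (hT.botE _)
    topI := sub hT.topI
    axK _ _ := sub (hT.axK _ _)
    axKdia _ _ := sub (hT.axKdia _ _)
    axDiaOr _ _ := sub (hT.axDiaOr _ _)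
    axFS _ _ := sub (hT.axFS _ _)
    axDiaBot := sub hT.axDiaBot
    mp := by
      rintro φ ψ ⟨γ₁, h₁, γ₂, h₂, h⟩ ⟨δ₁, k₁, δ₂, k₂, k⟩
      refine ⟨_, and_mem_diagram h₁ k₁, _, and_mem_diagram h₂ k₂, ?_⟩
      have h : hT.cls γ₁ ≤ hT.cls γ₂ ⇨ hT.cls φ ⇨ hT.cls ψ := h
      have k : hT.cls δ₁ ≤ hT.cls δ₂ ⇨ hT.cls φ := k
      suffices hT.cls γ₁ ⊓ hT.cls δ₁ ≤ hT.cls γ₂ ⊓ hT.cls δ₂ ⇨ hT.cls ψ from this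
      rw [le_himp_iff] at h k ⊢
      rw [inf_inf_inf_comm]
      exact (inf_le_inf h k).trans himp_inf_le
    nec := by
      rintro φ ⟨γ₁, h₁, γ₂, h₂, h⟩
      exact ⟨_, box_mem_diagram h₁, _, box_mem_diagram h₂,
        hT.imp_trans (hT.box_imp_box h) (hT.axK _ _)⟩ }

theorem cls_eq_cls_of_diagram {T : Set (Form V)} (hT : IsTheory T) {D : FSAlg} {v : V → D.carrier}
    {S : Set V} (hDT : diagram D v S ⊆ T) {φ ψ : Form V} (hφ : φ.vars ⊆ S) (hψ : ψ.vars ⊆ S)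
    (h : φ.eval D v = ψ.eval D v) : hT.cls φ = hT.cls ψ :=
  Quotient.sound ⟨hDT (imp_mem_diagram hφ hψ h.le), hDT (imp_mem_diagram hψ hφ h.ge)⟩

/-- The join of two diagrams over a common subalgebra is conservative over the first one. -/
theorem eval_eq_top_of_mem_join [Nonempty V] (hL : SuperFS L) (hCIP : CIP L)
    (hD₁ : IsFSLAlg L D₁) (hD₂ : IsFSLAlg L D₂) {A : FSAlg} {h₁ : A.carrier → D₁.carrier}
    {h₂ : A.carrier → D₂.carrier} (hh₁ : IsFSHom A D₁ h₁) (hh₂ : IsFSHom A D₂ h₂)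
    (inj₂ : Function.Injective h₂) (u : V → A.carrier)
    (hu₁ : ∀ x ∈ S₁ ∩ S₂, v₁ x = h₁ (u x)) (hu₂ : ∀ x ∈ S₁ ∩ S₂, v₂ x = h₂ (u x))
    {φ : Form V} (hφ : φ.vars ⊆ S₁)
    (h : φ ∈ join L (diagram D₁ v₁ S₁) (diagram D₂ v₂ S₂)) : φ.eval D₁ v₁ = ⊤ := by
  obtain ⟨γ₂, hγ₂, γ₁, hγ₁, h⟩ := join_comm hL _ _ h
  obtain ⟨χ, hχ, k₂, k₁⟩ := interpolation hL hCIP h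
  have hχS : χ.vars ⊆ S₁ ∩ S₂ := fun x hx =>
    ⟨Set.union_subset hγ₁.1 hφ (hχ hx).2, hγ₂.1 (hχ hx).1⟩
  have e₂ : χ.eval D₂ v₂ = ⊤ := by
    simpa [eval, hγ₂.2] using eval_eq_top_of_mem_logic hD₂ k₂ v₂
  have eA : χ.eval A u = ⊤ := inj₂ <| by
    rw [← eval_hom hh₂, hh₂.map_top, ← e₂]
    exact (eval_congr fun x hx => hu₂ x (hχS hx)).symm
  have e₁ : χ.eval D₁ v₁ = ⊤ := by
    rw [eval_congr fun x hx => hu₁ x (hχS hx), eval_hom hh₁, eA, hh₁.map_top]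
  simpa [eval, hγ₁.2, e₁] using eval_eq_top_of_mem_logic hD₁ k₁ v₁

/-- Over a theory containing the diagram of `D`, naming the elements of `D` by variables is an
FS-homomorphism into the Lindenbaum algebra. -/
theorem isFSHom_cls_var {T : Set (Form V)} (hT : IsTheory T) {D : FSAlg} {v : V → D.carrier}
    {S : Set V} (hDT : diagram D v S ⊆ T) {c : D.carrier → V} (hc : ∀ b, c b ∈ S)
    (hv : ∀ b, v (c b) = b) : IsFSHom D hT.lindenbaum fun b => hT.cls (var (c b)) := by
  have key {φ ψ : Form V} := cls_eq_cls_of_diagram (φ := φ) (ψ := ψ) hT hDT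
  constructor
  · exact key (φ := var (c ⊤)) (ψ := top) (by simp [vars, hc]) (by simp [vars]) (by simp [eval, hv])
  · exact key (φ := var (c ⊥)) (ψ := bot) (by simp [vars, hc]) (by simp [vars]) (by simp [eval, hv])
  · exact fun a b => key (φ := var (c (a ⊓ b))) (ψ := (var (c a)).and (var (c b)))
      (by simp [vars, hc]) (by simp [vars, hc, Set.insert_subset_iff]) (by simp [eval, hv])
  · exact fun a b => key (φ := var (c (a ⊔ b))) (ψ := (var (c a)).or (var (c b)))
      (by simp [vars, hc]) (by simp [vars, hc, Set.insert_subset_iff]) (by simp [eval, hv])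
  · exact fun a b => key (φ := var (c (a ⇨ b))) (ψ := (var (c a)).imp (var (c b)))
      (by simp [vars, hc]) (by simp [vars, hc, Set.insert_subset_iff]) (by simp [eval, hv])
  · exact fun a => key (φ := var (c (D.box a))) (ψ := (var (c a)).box)
      (by simp [vars, hc]) (by simp [vars, hc]) (by simp [eval, hv])
  · exact fun a => key (φ := var (c (D.dia a))) (ψ := (var (c a)).dia)
      (by simp [vars, hc]) (by simp [vars, hc]) (by simp [eval, hv])

theorem cls_var_injective {T : Set (Form V)} (hT : IsTheory T) {D : FSAlg} {v : V → D.carrier}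
    {S : Set V} (hTD : ∀ φ ∈ T, φ.vars ⊆ S → φ.eval D v = ⊤) {c : D.carrier → V}
    (hc : ∀ b, c b ∈ S) (hv : ∀ b, v (c b) = b) :
    Function.Injective fun b => hT.cls (var (c b)) := by
  have key {a b : D.carrier} (h : hT.cls (var (c a)) ≤ hT.cls (var (c b))) : a ≤ b := by
    simpa [eval, hv] using hTD _ (IsTheory.cls_le_cls.1 h) (by simp [vars, hc, Set.insert_subset_iff])
  exact fun a b h => le_antisymm (key h.le) (key h.ge)

end Diagrams

end Form

/-- if a super-FS logic L has the CIP, then the class of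
FS_L-algebras has the amalgamation property. -/
theorem CIP_implies_amalgamation (L : Set Fml) (hL : SuperFS L) (hCIP : CIP L)
    (A B₁ B₂ : FSAlg) (hA : IsFSLAlg L A) (hB₁ : IsFSLAlg L B₁) (hB₂ : IsFSLAlg L B₂)
    (h₁ : A.carrier → B₁.carrier) (h₂ : A.carrier → B₂.carrier)
    (hh₁ : IsFSHom A B₁ h₁) (hh₂ : IsFSHom A B₂ h₂)
    (inj₁ : Function.Injective h₁) (inj₂ : Function.Injective h₂) :
    ∃ (C : FSAlg) (p₁ : B₁.carrier → C.carrier) (p₂ : B₂.carrier → C.carrier),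
      IsFSLAlg L C ∧ IsFSHom B₁ C p₁ ∧ IsFSHom B₂ C p₂ ∧
      Function.Injective p₁ ∧ Function.Injective p₂ ∧ p₁ ∘ h₁ = p₂ ∘ h₂ := by
  let V := A.carrier ⊕ B₁.carrier ⊕ B₂.carrier
  let c₁ : B₁.carrier → V := fun b => .inr (.inl b)
  let c₂ : B₂.carrier → V := fun b => .inr (.inr b)
  let u : V → A.carrier := Sum.elim id fun _ => ⊤
  let v₁ : V → B₁.carrier := Sum.elim h₁ (Sum.elim id fun _ => ⊤)
  let v₂ : V → B₂.carrier := Sum.elim h₂ (Sum.elim (fun _ => ⊤) id)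
  let S₁ : Set V := Set.range Sum.inl ∪ Set.range c₁
  let S₂ : Set V := Set.range Sum.inl ∪ Set.range c₂
  have : Nonempty V := ⟨.inl ⊤⟩
  have hS : ∀ x ∈ S₁ ∩ S₂, v₁ x = h₁ (u x) ∧ v₂ x = h₂ (u x) := by
    rintro _ ⟨⟨a, rfl⟩ | ⟨b, rfl⟩, h⟩
    · exact ⟨rfl, rfl⟩
    · obtain ⟨a, ha⟩ | ⟨a, ha⟩ := h <;> cases ha
  let T₁ := Form.diagram B₁ v₁ S₁
  let T₂ := Form.diagram B₂ v₂ S₂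
  have hT : Form.IsTheory (Form.join L T₁ T₂) := Form.isTheory_join hL
  have sub₁ : T₁ ⊆ Form.join L T₁ T₂ := Form.diagram_subset_join hL
  have sub₂ : T₂ ⊆ Form.join L T₁ T₂ :=
    (Form.diagram_subset_join hL).trans (Form.join_comm hL T₂ T₁)
  have hc₁ (b) : c₁ b ∈ S₁ := .inr ⟨b, rfl⟩
  have hc₂ (b) : c₂ b ∈ S₂ := .inr ⟨b, rfl⟩
  refine ⟨hT.lindenbaum, fun b => hT.cls (.var (c₁ b)), fun b => hT.cls (.var (c₂ b)),
    Form.isFSLAlg_lindenbaum hL hT (Form.logic_subset_join hL),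
    Form.isFSHom_cls_var hT sub₁ hc₁ fun _ => rfl,
    Form.isFSHom_cls_var hT sub₂ hc₂ fun _ => rfl,
    Form.cls_var_injective (v := v₁) hT (fun φ h hφ => ?_) hc₁ fun _ => rfl,
    Form.cls_var_injective (v := v₂) hT (fun φ h hφ => ?_) hc₂ fun _ => rfl, funext fun a => ?_⟩
  · exact Form.eval_eq_top_of_mem_join hL hCIP hB₁ hB₂ hh₁ hh₂ inj₂ u
      (fun x hx => (hS x hx).1) (fun x hx => (hS x hx).2) hφ h
  · exact Form.eval_eq_top_of_mem_join hL hCIP hB₂ hB₁ hh₂ hh₁ inj₁ u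
      (fun x hx => (hS x hx.symm).2) (fun x hx => (hS x hx.symm).1) hφ (Form.join_comm hL _ _ h)
  · have ha₁ : (Sum.inl a : V) ∈ S₁ := .inl ⟨a, rfl⟩
    have ha₂ : (Sum.inl a : V) ∈ S₂ := .inl ⟨a, rfl⟩
    exact (Form.cls_eq_cls_of_diagram hT sub₁ (φ := .var (c₁ (h₁ a))) (ψ := .var (.inl a))
      (by simp [Form.vars, hc₁]) (by simp [Form.vars, ha₁]) rfl).trans
      (Form.cls_eq_cls_of_diagram hT sub₂ (φ := .var (.inl a)) (ψ := .var (c₂ (h₂ a)))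
      (by simp [Form.vars, ha₂]) (by simp [Form.vars, hc₂]) rfl)
end

section
/- The Fischer-Servi logic IK (the smallest super-FS logic) does not have the Craig interpolation property. -/
/-- The Fischer-Servi logic IK: the smallest super-FS logic. -/
def IK : Set Fml := {φ | ∀ L : Set Fml, SuperFS L → φ ∈ L}

/-- Birelational frames for intuitionistic modal logic. -/
structure BiFrame where
  /-- The set of worlds. -/
  World : Type
  /-- The intuitionistic order. -/
  le : World → World → Prop
  /-- The modal accessibility relation. -/
  acc : World → World → Prop
  le_refl : ∀ w, le w w
  le_trans : ∀ u v w, le u v → le v w → le u w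
  forward : ∀ w w' v, le w w' → acc w v → ∃ v', le v v' ∧ acc w' v'
  backward : ∀ w v v', acc w v → le v v' → ∃ w', le w w' ∧ acc w' v'

namespace BiFrame

variable (F : BiFrame)

/-- Truth of a formula at a world of a birelational frame under a valuation. -/
def Sat (V : F.World → ℕ → Prop) : Fml → F.World → Prop
  | .var n, w => V w n
  | .top, _ => True
  | .bot, _ => False
  | .and φ ψ, w => Sat V φ w ∧ Sat V ψ w
  | .or φ ψ, w => Sat V φ w ∨ Sat V ψ w
  | .imp φ ψ, w => ∀ w', F.le w w' → Sat V φ w' → Sat V ψ w'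
  | .box φ, w => ∀ w', F.le w w' → ∀ v, F.acc w' v → Sat V φ v
  | .dia φ, w => ∃ v, F.acc w v ∧ Sat V φ v

/-- A valuation is persistent if it is monotone along the intuitionistic order. -/
def Persistent (V : F.World → ℕ → Prop) : Prop :=
  ∀ n w w', F.le w w' → V w n → V w' n

/-- The formulas true at every world under every persistent valuation. -/
def validities : Set Fml := {φ | ∀ V, F.Persistent V → ∀ w, F.Sat V φ w}

variable {F}

theorem Sat.mono {V : F.World → ℕ → Prop} (hV : F.Persistent V) {φ : Fml} {w w' : F.World}
    (h : F.le w w') (hw : F.Sat V φ w) : F.Sat V φ w' := by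
  induction φ generalizing w w' with
  | var n => exact hV n w w' h hw
  | top => trivial
  | bot => exact hw
  | and φ ψ ihφ ihψ => exact ⟨ihφ h hw.1, ihψ h hw.2⟩
  | or φ ψ ihφ ihψ => exact hw.imp (ihφ h) (ihψ h)
  | imp φ ψ => exact fun u hu => hw u (F.le_trans _ _ _ h hu)
  | box φ => exact fun u hu => hw u (F.le_trans _ _ _ h hu)
  | dia φ ih =>
    obtain ⟨v, hv, hφ⟩ := hw
    obtain ⟨v', hvv', hv'⟩ := F.forward _ _ _ h hv
    exact ⟨v', hv', ih hvv' hφ⟩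

theorem sat_subst (V : F.World → ℕ → Prop) (σ : ℕ → Fml) (φ : Fml) (w : F.World) :
    F.Sat V (φ.subst σ) w ↔ F.Sat (fun u n => F.Sat V (σ n) u) φ w := by
  induction φ generalizing w <;> simp_all [Fml.subst, Sat]

theorem mem_validities_of_IPC {φ : Fml} (h : IPC φ) : φ ∈ F.validities := by
  intro V hV
  induction h with
  | ax1 φ ψ => exact fun w u _ hφ v huv _ => hφ.mono hV huv
  | ax2 φ ψ χ =>
    exact fun w u _ h₁ v huv h₂ x hvx hφ =>
      h₁ x (F.le_trans _ _ _ huv hvx) hφ x (F.le_refl x) (h₂ x hvx hφ)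
  | andE1 φ ψ => exact fun w u _ h => h.1
  | andE2 φ ψ => exact fun w u _ h => h.2
  | andI φ ψ => exact fun w u _ hφ v huv hψ => ⟨hφ.mono hV huv, hψ⟩
  | orI1 φ ψ => exact fun w u _ h => Or.inl h
  | orI2 φ ψ => exact fun w u _ h => Or.inr h
  | orE φ ψ χ =>
    exact fun w u _ h₁ v huv h₂ x hvx h =>
      h.elim (h₁ x (F.le_trans _ _ _ huv hvx)) (h₂ x hvx)
  | botE φ => exact fun w u _ h => h.elim
  | topI => exact fun w => trivial
  | mp φ ψ _ _ ih₁ ih₂ => exact fun w => ih₁ w w (F.le_refl w) (ih₂ w)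

variable (F) in
theorem superFS_validities : SuperFS F.validities where
  ipc _ h := mem_validities_of_IPC h
  axK p q V hV w u _ h₁ v huv h₂ x hvx y hxy :=
    h₁ x (F.le_trans _ _ _ huv hvx) y hxy y (F.le_refl y) (h₂ x hvx y hxy)
  axKdia p q V hV w u _ h₁ v huv h₂ := by
    obtain ⟨y, hvy, hy⟩ := h₂
    exact ⟨y, hvy, h₁ v huv y hvy y (F.le_refl y) hy⟩
  axDiaOr p q V hV w u _ h := by
    obtain ⟨y, huy, hy⟩ := h
    exact hy.imp (fun h => ⟨y, huy, h⟩) (fun h => ⟨y, huy, h⟩)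
  axFS p q V hV w u _ h v huv y hvy z hyz hz := by
    obtain ⟨x, hvx, hxz⟩ := F.backward _ _ _ hvy hyz
    exact h x (F.le_trans _ _ _ huv hvx) ⟨z, hxz, hz⟩ x (F.le_refl x) z hxz
  axDiaBot V hV w u _ h := by
    obtain ⟨_, _, h⟩ := h
    exact h
  subst φ h σ V hV w :=
    (sat_subst V σ φ w).2 (h _ (fun _ _ _ huv hu => hu.mono hV huv) w)
  mp φ ψ h₁ h₂ V hV w := h₁ V hV w w (F.le_refl w) (h₂ V hV w)
  nec φ h V hV w u _ v _ := h V hV v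

theorem sat_of_mem_IK {φ : Fml} (h : φ ∈ IK) {V : F.World → ℕ → Prop} (hV : F.Persistent V)
    (w : F.World) : F.Sat V φ w :=
  h _ F.superFS_validities V hV w

end BiFrame

namespace SuperFS

variable {L : Set Fml}

theorem imp_of_mem (hL : SuperFS L) {φ : Fml} (γ : Fml) (h : φ ∈ L) : γ.imp φ ∈ L :=
  hL.mp _ _ (hL.ipc _ (.ax1 φ γ)) h

theorem imp_mp (hL : SuperFS L) {γ φ ψ : Fml}
    (h₁ : γ.imp (φ.imp ψ) ∈ L) (h₂ : γ.imp φ ∈ L) : γ.imp ψ ∈ L :=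
  hL.mp _ _ (hL.mp _ _ (hL.ipc _ (.ax2 γ φ ψ)) h₁) h₂

theorem imp_trans (hL : SuperFS L) {φ ψ χ : Fml}
    (h₁ : φ.imp ψ ∈ L) (h₂ : ψ.imp χ ∈ L) :
    φ.imp χ ∈ L :=
  hL.imp_mp (hL.imp_of_mem φ h₂) h₁

theorem imp_comp (hL : SuperFS L) {γ φ ψ χ : Fml}
    (h₁ : γ.imp (φ.imp ψ) ∈ L) (h₂ : γ.imp (ψ.imp χ) ∈ L) :
    γ.imp (φ.imp χ) ∈ L :=
  hL.imp_mp (hL.imp_trans (hL.imp_trans h₂ (hL.ipc _ (.ax1 _ φ))) (hL.ipc _ (.ax2 φ ψ χ))) h₁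

theorem curry (hL : SuperFS L) {φ ψ χ : Fml} (h : (φ.and ψ).imp χ ∈ L) : φ.imp (ψ.imp χ) ∈ L :=
  hL.imp_comp (hL.ipc _ (.andI φ ψ)) (hL.imp_of_mem φ h)

theorem imp_box_mp (hL : SuperFS L) {γ φ ψ : Fml}
    (h₁ : γ.imp (φ.imp ψ).box ∈ L) (h₂ : γ.imp φ.box ∈ L) :
    γ.imp ψ.box ∈ L :=
  hL.imp_mp (hL.imp_trans h₁ (hL.axK φ ψ)) h₂

theorem box_or_imp_mem (hL : SuperFS L) (a b q r : Fml) :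
    ((a.or q).box.and (q.dia.imp b)).imp
      (((b.imp r.box).and (a.imp r).box).imp r.box) ∈ L := by
  apply hL.curry
  set φ := (a.or q).box.and (q.dia.imp b)
  set ψ := (b.imp r.box).and (a.imp r).box
  have hφ : (φ.and ψ).imp φ ∈ L := hL.ipc _ (.andE1 _ _)
  have hψ : (φ.and ψ).imp ψ ∈ L := hL.ipc _ (.andE2 _ _)
  have h₁ := hL.imp_trans hφ (hL.ipc _ (.andE1 _ _))
  have h₂ := hL.imp_trans hφ (hL.ipc _ (.andE2 _ _))
  have h₃ := hL.imp_trans hψ (hL.ipc _ (.andE1 _ _))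
  have h₄ := hL.imp_trans hψ (hL.ipc _ (.andE2 _ _))
  have h₅ := hL.imp_trans (hL.imp_comp h₂ h₃) (hL.axFS q r)
  have h₆ := hL.imp_of_mem (φ.and ψ) (hL.nec _ (hL.ipc _ (.orE a q r)))
  exact hL.imp_box_mp (hL.imp_box_mp (hL.imp_box_mp h₆ h₄) h₅) h₁

end SuperFS

/-- A frame whose worlds `0` and `1` can be told apart by means of auxiliary variables only:
`0` sees `5`, `1` sees `3` and `5`, and their common successor `2` sees `4`, `5` and `6`,
where `3 ≤ 4 ≤ 6`. -/
def splitFrame : BiFrame where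
  World := Fin 7
  le w v := w = v ∨ (w, v) ∈ [((0 : Fin 7), (2 : Fin 7)), (1, 2), (3, 4), (3, 6), (4, 6)]
  acc w v := (w, v) ∈ [((0 : Fin 7), (5 : Fin 7)), (1, 3), (1, 5), (2, 4), (2, 5), (2, 6)]
  le_refl _ := Or.inl rfl
  le_trans := by decide
  forward := by decide
  backward := by decide

/-- The valuation on `splitFrame` with variable `0` true at `5`, `6`, variable `1` at `2`,
variable `2` at `4`, `6`, and variable `3` at `4`, `5`, `6`. -/
def splitVal (w : Fin 7) (n : ℕ) : Prop :=
  (w, n) ∈ [((5 : Fin 7), 0), (6, 0), (2, 1), (4, 2), (6, 2), (4, 3), (5, 3), (6, 3)]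

theorem splitVal_persistent : splitFrame.Persistent splitVal := by
  intro n w w' h hw
  change Fin 7 at w w'
  simp only [splitFrame, splitVal, List.mem_cons, Prod.mk.injEq, List.not_mem_nil] at h hw ⊢
  grind

theorem splitFrame_forall_le (P : Fin 7 → Prop) (w : Fin 7) :
    (∀ v, splitFrame.le w v → P v) ↔
      P w ∧ (w = 0 ∨ w = 1 → P 2) ∧ (w = 3 → P 4) ∧ (w = 3 ∨ w = 4 → P 6) := by
  simp only [splitFrame, List.mem_cons, Prod.mk.injEq, List.not_mem_nil]
  grind

theorem splitFrame_forall_acc (P : Fin 7 → Prop) (w : Fin 7) :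
    (∀ v, splitFrame.acc w v → P v) ↔
      (w = 1 → P 3) ∧ (w = 2 → P 4) ∧ (w = 0 ∨ w = 1 ∨ w = 2 → P 5) ∧ (w = 2 → P 6) := by
  simp only [splitFrame, List.mem_cons, Prod.mk.injEq, List.not_mem_nil]
  grind

theorem splitFrame_exists_acc (P : Fin 7 → Prop) (w : Fin 7) :
    (∃ v, splitFrame.acc w v ∧ P v) ↔
      (w = 1 ∧ P 3) ∨ (w = 2 ∧ P 4) ∨ ((w = 0 ∨ w = 1 ∨ w = 2) ∧ P 5) ∨ (w = 2 ∧ P 6) := by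
  simp only [splitFrame, List.mem_cons, Prod.mk.injEq, List.not_mem_nil]
  grind

/-- Truth at a world of `splitFrame` under `splitVal`. -/
def SplitSat (φ : Fml) (w : Fin 7) : Prop := splitFrame.Sat splitVal φ w

theorem splitSat_imp (φ ψ : Fml) (w : Fin 7) :
    SplitSat (φ.imp ψ) w ↔
      (SplitSat φ w → SplitSat ψ w) ∧ (w = 0 ∨ w = 1 → SplitSat φ 2 → SplitSat ψ 2) ∧
        (w = 3 → SplitSat φ 4 → SplitSat ψ 4) ∧
        (w = 3 ∨ w = 4 → SplitSat φ 6 → SplitSat ψ 6) :=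
  splitFrame_forall_le (fun v => SplitSat φ v → SplitSat ψ v) w

theorem splitSat_box (φ : Fml) (w : Fin 7) :
    SplitSat φ.box w ↔
      (w = 1 → SplitSat φ 3) ∧
        (w = 0 ∨ w = 1 ∨ w = 2 → SplitSat φ 4 ∧ SplitSat φ 5 ∧ SplitSat φ 6) := by
  refine (splitFrame_forall_le (fun v => ∀ u, splitFrame.acc v u → SplitSat φ u) w).trans ?_
  simp only [splitFrame_forall_acc]
  grind

theorem splitSat_dia (φ : Fml) (w : Fin 7) :
    SplitSat φ.dia w ↔
      (w = 1 ∧ SplitSat φ 3) ∨ (w = 2 ∧ SplitSat φ 4) ∨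
        ((w = 0 ∨ w = 1 ∨ w = 2) ∧ SplitSat φ 5) ∨ (w = 2 ∧ SplitSat φ 6) :=
  splitFrame_exists_acc (SplitSat φ) w

theorem splitSat_and (φ ψ : Fml) (w : Fin 7) :
    SplitSat (φ.and ψ) w ↔ SplitSat φ w ∧ SplitSat ψ w := Iff.rfl

theorem splitSat_or (φ ψ : Fml) (w : Fin 7) :
    SplitSat (φ.or ψ) w ↔ SplitSat φ w ∨ SplitSat ψ w := Iff.rfl

theorem splitSat_var (n : ℕ) (w : Fin 7) : SplitSat (.var n) w ↔ splitVal w n := Iff.rfl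

theorem splitSat_congr {χ : Fml} (h : χ.vars ⊆ {0, 1}) :
    (SplitSat χ 0 ↔ SplitSat χ 1) ∧ (SplitSat χ 3 ↔ SplitSat χ 4) ∧
      (SplitSat χ 5 ↔ SplitSat χ 6) := by
  induction χ with
  | var n =>
    have hn : n = 0 ∨ n = 1 := by simpa [Fml.vars] using h
    rcases hn with rfl | rfl <;> simp [splitSat_var, splitVal]
  | top => exact ⟨Iff.rfl, Iff.rfl, Iff.rfl⟩
  | bot => exact ⟨Iff.rfl, Iff.rfl, Iff.rfl⟩
  | and φ ψ ihφ ihψ =>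
    obtain ⟨hφ, hψ⟩ := Set.union_subset_iff.1 h
    simp [splitSat_and, ihφ hφ, ihψ hψ]
  | or φ ψ ihφ ihψ =>
    obtain ⟨hφ, hψ⟩ := Set.union_subset_iff.1 h
    simp [splitSat_or, ihφ hφ, ihψ hψ]
  | imp φ ψ ihφ ihψ =>
    obtain ⟨hφ, hψ⟩ := Set.union_subset_iff.1 h
    simp [splitSat_imp, ihφ hφ, ihψ hψ]
  | box φ ih =>
    have := ih h
    simp [splitSat_box]
    tauto
  | dia φ ih =>
    have := ih h
    have hmono : SplitSat φ 3 → SplitSat φ 6 :=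
      BiFrame.Sat.mono splitVal_persistent (by simp [splitFrame])
    simp [splitSat_dia]
    tauto

/-- IK does not have the Craig interpolation property. -/
theorem IK_no_CIP : ¬ CIP IK := by
  intro hCIP
  obtain ⟨χ, hχ, h₁, h₂⟩ := hCIP _ _ fun L hL =>
    SuperFS.box_or_imp_mem hL (.var 0) (.var 1) (.var 2) (.var 3)
  have hvars : χ.vars ⊆ {0, 1} := by
    refine hχ.trans fun n hn => ?_
    simp only [Fml.vars, Set.mem_inter_iff, Set.mem_union, Set.mem_singleton_iff,
      Set.mem_insert_iff] at hn ⊢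
    omega
  have hχ₀ : SplitSat χ 0 := by
    refine BiFrame.sat_of_mem_IK h₁ splitVal_persistent (0 : Fin 7) (0 : Fin 7)
      (splitFrame.le_refl _) ?_
    change SplitSat _ _
    simp [splitSat_and, splitSat_or, splitSat_imp, splitSat_box, splitSat_dia, splitSat_var,
      splitVal]
  have hχ₁ : SplitSat χ 1 := (splitSat_congr hvars).1.1 hχ₀
  have hψ : SplitSat _ 1 :=
    BiFrame.sat_of_mem_IK h₂ splitVal_persistent (1 : Fin 7) (1 : Fin 7)
      (splitFrame.le_refl _) hχ₁
  simp [splitSat_and, splitSat_imp, splitSat_box, splitSat_var, splitVal] at hψ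
end

section
/- The intuitionistic modal logic IKT, defined as the smallest super-FS logic containing the axioms □p → p and p → ◇p, does not have the Craig interpolation property. -/
/-- The T axiom □p → p. -/
def axT : Fml := ((Fml.var 0).box).imp (Fml.var 0)

/-- The T axiom p → ◇p. -/
def axTdia : Fml := (Fml.var 0).imp ((Fml.var 0).dia)

/-- IKT: the smallest super-FS logic containing □p → p and p → ◇p. -/
def IKT : Set Fml := {φ | ∀ L : Set Fml, SuperFS L → axT ∈ L → axTdia ∈ L → φ ∈ L}

/-! ### Kripke semantics -/

/-- A reflexive birelational frame satisfying the two Fischer Servi confluence conditions. -/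
structure IKTFrame (W : Type) where
  le : W → W → Prop
  R : W → W → Prop
  le_refl : ∀ x, le x x
  le_trans : ∀ x y z, le x y → le y z → le x z
  R_refl : ∀ x, R x x
  forth_up : ∀ x y z, R x y → le y z → ∃ u, le x u ∧ R u z
  forth_down : ∀ x y z, le x y → R x z → ∃ u, le z u ∧ R y u

namespace IKTFrame

variable {W : Type} (F : IKTFrame W)

/-- The forcing relation on a frame under a valuation. -/
def Forces (V : ℕ → W → Prop) : Fml → W → Prop
  | .var n, x => V n x
  | .top, _ => True
  | .bot, _ => False
  | .and φ ψ, x => Forces V φ x ∧ Forces V ψ x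
  | .or φ ψ, x => Forces V φ x ∨ Forces V ψ x
  | .imp φ ψ, x => ∀ y, F.le x y → Forces V φ y → Forces V ψ y
  | .box φ, x => ∀ y, F.le x y → ∀ z, F.R y z → Forces V φ z
  | .dia φ, x => ∃ y, F.R x y ∧ Forces V φ y

/-- Valuations by up-closed sets. -/
def Persistent (V : ℕ → W → Prop) : Prop := ∀ n x y, F.le x y → V n x → V n y

variable {F}

theorem Forces.mono {V : ℕ → W → Prop} (hV : F.Persistent V) (φ : Fml) :
    ∀ {x y : W}, F.le x y → F.Forces V φ x → F.Forces V φ y := by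
  induction φ with
  | var n => exact fun h => hV n _ _ h
  | top => exact fun _ h => h
  | bot => exact fun _ h => h
  | and φ ψ ih₁ ih₂ => exact fun h hx => ⟨ih₁ h hx.1, ih₂ h hx.2⟩
  | or φ ψ ih₁ ih₂ => exact fun h hx => hx.imp (ih₁ h) (ih₂ h)
  | imp φ ψ => exact fun h hx z hz => hx z (F.le_trans _ _ _ h hz)
  | box φ => exact fun h hx z hz => hx z (F.le_trans _ _ _ h hz)
  | dia φ ih =>
    rintro x y h ⟨z, hz, hφ⟩
    obtain ⟨u, hu, hyu⟩ := F.forth_down x y z h hz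
    exact ⟨u, hyu, ih hu hφ⟩

theorem forces_subst (V : ℕ → W → Prop) (σ : ℕ → Fml) (φ : Fml) :
    ∀ x, F.Forces V (φ.subst σ) x ↔ F.Forces (fun n => F.Forces V (σ n)) φ x := by
  induction φ <;> simp_all [Forces, Fml.subst]

variable (F) in
/-- The formulas valid on a frame. -/
def logic : Set Fml := {φ | ∀ V, F.Persistent V → ∀ x, F.Forces V φ x}

theorem ipc_subset_logic {φ : Fml} (h : IPC φ) : φ ∈ F.logic := by
  intro V hV
  induction h with
  | ax1 φ ψ => exact fun x y _ h z hz _ => h.mono hV _ hz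
  | ax2 φ ψ χ =>
    exact fun x y _ h z hz h' u hu hφ =>
      h u (F.le_trans _ _ _ hz hu) hφ u (F.le_refl u) (h' u hu hφ)
  | andE1 => exact fun x y _ h => h.1
  | andE2 => exact fun x y _ h => h.2
  | andI φ ψ => exact fun x y _ h z hz h' => ⟨h.mono hV _ hz, h'⟩
  | orI1 => exact fun x y _ h => Or.inl h
  | orI2 => exact fun x y _ h => Or.inr h
  | orE φ ψ χ =>
    exact fun x y _ h z hz h' u hu hor =>
      hor.elim (h u (F.le_trans _ _ _ hz hu)) (h' u hu)
  | botE => exact fun x y _ h => h.elim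
  | topI => exact fun _ => trivial
  | mp φ ψ _ _ ih₁ ih₂ => exact fun x => ih₁ x x (F.le_refl x) (ih₂ x)

theorem superFS_logic : SuperFS F.logic where
  ipc _ h := ipc_subset_logic h
  axK p q := fun V hV x y _ h z hz h' u hu v hv =>
    h u (F.le_trans _ _ _ hz hu) v hv v (F.le_refl v) (h' u hu v hv)
  axKdia p q := by
    rintro V hV x y _ h z hz ⟨u, hu, hp⟩
    exact ⟨u, hu, h z hz u hu u (F.le_refl u) hp⟩
  axDiaOr p q := by
    rintro V hV x y _ ⟨u, hu, hp | hq⟩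
    exacts [Or.inl ⟨u, hu, hp⟩, Or.inr ⟨u, hu, hq⟩]
  axFS p q := by
    intro V hV x y _ h z hz u hu v hv hp
    obtain ⟨z', hzz', hz'v⟩ := F.forth_up z u v hu hv
    exact h z' (F.le_trans _ _ _ hz hzz') ⟨v, hz'v, hp⟩ z' (F.le_refl z') v hz'v
  axDiaBot := by
    rintro V hV x y _ ⟨u, _, h⟩
    exact h
  subst φ h σ V hV x :=
    (forces_subst V σ φ x).2 (h _ (fun n _ _ hxy hx => hx.mono hV (σ n) hxy) x)
  mp φ ψ h h' V hV x := h V hV x x (F.le_refl x) (h' V hV x)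
  nec φ h V hV x y _ z _ := h V hV z

theorem IKT_subset_logic {φ : Fml} (h : φ ∈ IKT) : φ ∈ F.logic :=
  h _ superFS_logic (fun _ _ _ y _ h' => h' y (F.le_refl y) y (F.R_refl y))
    (fun _ _ _ y _ h' => ⟨y, F.R_refl y, h'⟩)

/-- Points related by a bisimulation between two models on `F` agree on all formulas in the
variables on which the bisimulation respects the valuations. -/
theorem forces_iff_of_bisim {V V' : ℕ → W → Prop} {Z : W → W → Prop} {S : Set ℕ}
    (hvar : ∀ n ∈ S, ∀ x y, Z x y → (V n x ↔ V' n y))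
    (le_forth : ∀ x y x', Z x y → F.le x x' → ∃ y', F.le y y' ∧ Z x' y')
    (le_back : ∀ x y y', Z x y → F.le y y' → ∃ x', F.le x x' ∧ Z x' y')
    (R_forth : ∀ x y x', Z x y → F.R x x' → ∃ y', F.R y y' ∧ Z x' y')
    (R_back : ∀ x y y', Z x y → F.R y y' → ∃ x', F.R x x' ∧ Z x' y')
    (φ : Fml) (hφ : φ.vars ⊆ S) :
    ∀ x y, Z x y → (F.Forces V φ x ↔ F.Forces V' φ y) := by
  induction φ with
  | var n => exact hvar n (hφ rfl)
  | top => exact fun _ _ _ => Iff.rfl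
  | bot => exact fun _ _ _ => Iff.rfl
  | and φ ψ ih₁ ih₂ =>
    obtain ⟨h₁, h₂⟩ := Set.union_subset_iff.1 hφ
    exact fun x y h => and_congr (ih₁ h₁ x y h) (ih₂ h₂ x y h)
  | or φ ψ ih₁ ih₂ =>
    obtain ⟨h₁, h₂⟩ := Set.union_subset_iff.1 hφ
    exact fun x y h => or_congr (ih₁ h₁ x y h) (ih₂ h₂ x y h)
  | imp φ ψ ih₁ ih₂ =>
    obtain ⟨h₁, h₂⟩ := Set.union_subset_iff.1 hφ
    intro x y h
    constructor
    · intro hx y' hy' hf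
      obtain ⟨x', hx', hZ⟩ := le_back x y y' h hy'
      exact (ih₂ h₂ x' y' hZ).1 (hx x' hx' ((ih₁ h₁ x' y' hZ).2 hf))
    · intro hy x' hx' hf
      obtain ⟨y', hy', hZ⟩ := le_forth x y x' h hx'
      exact (ih₂ h₂ x' y' hZ).2 (hy y' hy' ((ih₁ h₁ x' y' hZ).1 hf))
  | box φ ih =>
    intro x y h
    constructor
    · intro hx y' hy' v hv
      obtain ⟨x', hx', hZ⟩ := le_back x y y' h hy'
      obtain ⟨u, hu, hZ'⟩ := R_back x' y' v hZ hv
      exact (ih hφ u v hZ').1 (hx x' hx' u hu)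
    · intro hy x' hx' u hu
      obtain ⟨y', hy', hZ⟩ := le_forth x y x' h hx'
      obtain ⟨v, hv, hZ'⟩ := R_forth x' y' u hZ hu
      exact (ih hφ u v hZ').2 (hy y' hy' v hv)
  | dia φ ih =>
    intro x y h
    constructor
    · rintro ⟨u, hu, hf⟩
      obtain ⟨v, hv, hZ⟩ := R_forth x y u h hu
      exact ⟨v, hv, (ih hφ u v hZ).1 hf⟩
    · rintro ⟨v, hv, hf⟩
      obtain ⟨u, hu, hZ⟩ := R_back x y v h hv
      exact ⟨u, hu, (ih hφ u v hZ).2 hf⟩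

end IKTFrame

/-! ### Derivations in super-FS logics -/

namespace SuperFS

variable {L : Set Fml} {γ α β δ : Fml}

theorem weaken (h : SuperFS L) (hα : α ∈ L) : γ.imp α ∈ L :=
  h.mp _ _ (h.ipc _ (.ax1 α γ)) hα

theorem app (h : SuperFS L) (hαβ : γ.imp (α.imp β) ∈ L) (hα : γ.imp α ∈ L) : γ.imp β ∈ L :=
  h.mp _ _ (h.mp _ _ (h.ipc _ (.ax2 γ α β)) hαβ) hα

theorem trans (h : SuperFS L) (hαβ : α.imp β ∈ L) (hβδ : β.imp δ ∈ L) : α.imp δ ∈ L :=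
  h.app (h.weaken hβδ) hαβ

theorem imp_self (h : SuperFS L) : γ.imp γ ∈ L :=
  h.app (β := γ) (α := γ.imp γ) (h.ipc _ (.ax1 _ _)) (h.ipc _ (.ax1 _ _))

theorem left (h : SuperFS L) (hαβ : γ.imp (α.and β) ∈ L) : γ.imp α ∈ L :=
  h.trans hαβ (h.ipc _ (.andE1 α β))

theorem right (h : SuperFS L) (hαβ : γ.imp (α.and β) ∈ L) : γ.imp β ∈ L :=
  h.trans hαβ (h.ipc _ (.andE2 α β))

theorem pair (h : SuperFS L) (hα : γ.imp α ∈ L) (hβ : γ.imp β ∈ L) : γ.imp (α.and β) ∈ L :=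
  h.app (h.app (h.weaken (h.ipc _ (.andI α β))) hα) hβ

theorem curry_s7 (h : SuperFS L) (hβ : (γ.and α).imp β ∈ L) : γ.imp (α.imp β) ∈ L := by
  have hpair : γ.imp (α.imp (γ.and α)) ∈ L := h.ipc _ (.andI γ α)
  have hcomp : (α.imp (γ.and α)).imp (α.imp β) ∈ L :=
    h.mp _ _ (h.ipc _ (.ax2 α (γ.and α) β)) (h.weaken hβ)
  exact h.trans hpair hcomp

theorem hyp (h : SuperFS L) : (γ.and α).imp α ∈ L := h.ipc _ (.andE2 γ α)

theorem lift (h : SuperFS L) (hβ : γ.imp β ∈ L) : (γ.and α).imp β ∈ L :=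
  h.trans (h.ipc _ (.andE1 γ α)) hβ

theorem cases (h : SuperFS L) (hαβ : γ.imp (α.or β) ∈ L) (hα : (γ.and α).imp δ ∈ L)
    (hβ : (γ.and β).imp δ ∈ L) : γ.imp δ ∈ L :=
  h.app (h.app (h.app (h.weaken (h.ipc _ (.orE α β δ))) (h.curry_s7 hα)) (h.curry_s7 hβ)) hαβ

theorem exfalso (h : SuperFS L) (hbot : γ.imp .bot ∈ L) : γ.imp α ∈ L :=
  h.trans hbot (h.ipc _ (.botE α))

theorem dia_mono (h : SuperFS L) (hαβ : α.imp β ∈ L) : α.dia.imp β.dia ∈ L :=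
  h.mp _ _ (h.axKdia α β) (h.nec _ hαβ)

theorem box_mono (h : SuperFS L) (hαβ : α.imp β ∈ L) : α.box.imp β.box ∈ L :=
  h.mp _ _ (h.axK α β) (h.nec _ hαβ)

/-- If `◇p → ¬b` and `◇q → b`, then `□¬(p ∧ q)`. -/
theorem box_disjoint (h : SuperFS L) {p q b : Fml}
    (hp : γ.imp (p.dia.imp (b.imp .bot)) ∈ L) (hq : γ.imp (q.dia.imp b) ∈ L) :
    γ.imp ((p.and q).imp .bot).box ∈ L := by
  refine h.trans (h.curry_s7 ?_) (h.axFS (p.and q) .bot)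
  have hdp := h.trans (h.hyp (γ := γ)) (h.dia_mono (h.ipc _ (.andE1 p q)))
  have hdq := h.trans (h.hyp (γ := γ)) (h.dia_mono (h.ipc _ (.andE2 p q)))
  exact h.exfalso (h.app (h.app (h.lift hp) hdp) (h.app (h.lift hq) hdq))

/-- The propositional core of `leftFml → rightFml`. -/
theorem core (h : SuperFS L) (p q s t : Fml) :
    ((p.and q).imp .bot).imp ((((q.and t).imp s).imp t).imp ((t.imp (p.or s)).imp t)) ∈ L := by
  refine h.curry_s7 (h.curry_s7 (h.app (h.lift h.hyp) (h.curry_s7 ?_)))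
  have hq := h.left (h.hyp (γ := (((p.and q).imp .bot).and (((q.and t).imp s).imp t)).and
    (t.imp (p.or s))) (α := q.and t))
  have ht := h.right (h.hyp (γ := (((p.and q).imp .bot).and (((q.and t).imp s).imp t)).and
    (t.imp (p.or s))) (α := q.and t))
  refine h.cases (h.app (h.lift h.hyp) ht) ?_ h.hyp
  exact h.exfalso (h.app (h.lift (h.lift (h.lift (h.lift h.imp_self)))) (h.pair h.hyp (h.lift hq)))

end SuperFS

/-! ### The implication without interpolant -/

/-- `◇(t → p ∨ s) ∧ (◇p → ¬b)`. -/
def leftFml (p b s t : Fml) : Fml :=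
  (t.imp (p.or s)).dia.and (p.dia.imp (b.imp .bot))

/-- `□((q ∧ t → s) → t) ∧ (◇q → b) → ◇t`. -/
def rightFml (q b s t : Fml) : Fml :=
  ((((q.and t).imp s).imp t).box.and (q.dia.imp b)).imp t.dia

theorem leftFml_imp_rightFml_mem_IKT (p q b s t : Fml) :
    (leftFml p b s t).imp (rightFml q b s t) ∈ IKT := by
  intro L h _ _
  refine h.curry_s7 ?_
  have hdis := h.box_disjoint (h.right (h.lift h.imp_self)) (h.right (h.hyp
    (γ := leftFml p b s t) (α := (((q.and t).imp s).imp t).box.and (q.dia.imp b))))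
  have hbox := h.app (h.trans (h.trans hdis (h.box_mono (h.core p q s t))) (h.axK _ _))
    (h.left h.hyp)
  exact h.app (h.trans hbox (h.axKdia _ _)) (h.left (h.lift h.imp_self))

/-- The points of the separating frame: a root `w` below `a` and `b`, and `v` below `v₁` and `u`,
with a further isolated point `v₂`. -/
inductive Pt : Type
  | w | a | b | v | v₁ | v₂ | u
  deriving DecidableEq

namespace Pt

instance : Fintype Pt := ⟨{w, a, b, v, v₁, v₂, u}, by rintro (_ | _) <;> decide⟩

/-- The intuitionistic order. -/
def le : Pt → Pt → Bool
  | w, w | w, a | w, b | a, a | b, b | v, v | v, v₁ | v, u | v₁, v₁ | v₂, v₂ | u, u => true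
  | _, _ => false

/-- The modal accessibility relation. -/
def acc : Pt → Pt → Bool
  | w, w | w, v | a, a | a, v₁ | a, v₂ | a, u | b, b | b, v₂ | b, u => true
  | v, v | v₁, v₁ | v₂, v₂ | u, u => true
  | _, _ => false

/-- The separating frame. -/
def frame : IKTFrame Pt where
  le x y := le x y
  R x y := acc x y
  le_refl := by decide
  le_trans := by decide
  R_refl := by decide
  forth_up := by decide
  forth_down := by decide

/-- Truth of the common variables `3` and `4`. -/
def common : ℕ → Pt → Bool
  | 3, u => true
  | 4, a | 4, b | 4, v₁ | 4, v₂ | 4, u => true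
  | _, _ => false

/-- The valuation verifying `leftFml`. -/
def valLeft : ℕ → Pt → Bool
  | 0, v₁ => true
  | 2, b => true
  | n, x => common n x

/-- The valuation refuting `rightFml`. -/
def valRight : ℕ → Pt → Bool
  | 1, v₁ | 1, a => true
  | 2, a => true
  | n, x => common n x

/-- The bisimulation exchanging `a` with `b` and identifying `v₁` with `v₂`. -/
def bisim : Pt → Pt → Bool
  | w, w | a, b | b, a | v, v | v₁, v₁ | v₁, v₂ | v₂, v₁ | v₂, v₂ | u, u => true
  | _, _ => false

theorem persistent_valLeft : frame.Persistent (fun n x => valLeft n x) := by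
  intro n x y
  match n with
  | 0 | 1 | 2 | 3 | 4 => revert x y; simp only [frame]; decide
  | n + 5 => simp [valLeft, common]

theorem persistent_valRight : frame.Persistent (fun n x => valRight n x) := by
  intro n x y
  match n with
  | 0 | 1 | 2 | 3 | 4 => revert x y; simp only [frame]; decide
  | n + 5 => simp [valRight, common]

theorem forces_leftFml :
    frame.Forces (fun n x => valLeft n x) (leftFml (.var 0) (.var 2) (.var 3) (.var 4)) w := by
  simp only [leftFml, IKTFrame.Forces, frame]
  decide

theorem not_forces_rightFml :
    ¬ frame.Forces (fun n x => valRight n x) (rightFml (.var 1) (.var 2) (.var 3) (.var 4)) w := by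
  simp only [rightFml, IKTFrame.Forces, frame]
  intro h
  exact absurd (h w rfl ⟨by decide, by decide⟩) (by decide)

theorem forces_iff_of_vars_subset {χ : Fml} (hχ : χ.vars ⊆ {2, 3, 4}) :
    frame.Forces (fun n x => valLeft n x) χ w ↔ frame.Forces (fun n x => valRight n x) χ w := by
  refine IKTFrame.forces_iff_of_bisim (Z := fun x y => bisim x y) (S := {2, 3, 4})
    ?_ ?_ ?_ ?_ ?_ χ hχ w w rfl
  · rintro n (rfl | rfl | rfl) <;> decide
  all_goals
    simp only [frame]
    decide

end Pt

/-- IKT does not have the Craig interpolation property. -/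
theorem IKT_no_CIP : ¬ CIP IKT := by
  intro hCIP
  obtain ⟨χ, hvars, hleft, hright⟩ := hCIP _ _
    (leftFml_imp_rightFml_mem_IKT (.var 0) (.var 1) (.var 2) (.var 3) (.var 4))
  have hχ : χ.vars ⊆ {2, 3, 4} := by
    refine hvars.trans ?_
    rintro n ⟨h₁, h₂⟩
    simp only [leftFml, rightFml, Fml.vars, Set.mem_union, Set.mem_singleton_iff,
      Set.mem_empty_iff_false, Set.mem_insert_iff] at h₁ h₂ ⊢
    grind
  have h₁ := IKTFrame.IKT_subset_logic hleft _ Pt.persistent_valLeft .w .w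
    (Pt.frame.le_refl _) Pt.forces_leftFml
  have h₂ := (Pt.forces_iff_of_vars_subset hχ).1 h₁
  exact Pt.not_forces_rightFml (IKTFrame.IKT_subset_logic hright _ Pt.persistent_valRight .w .w
    (Pt.frame.le_refl _) h₂)
end

section
/- The intuitionistic modal logic IS4, defined as the smallest super-FS logic containing the axioms □p → p, p → ◇p, □p → □□p, and ◇◇p → ◇p, does not have the Craig interpolation property. -/
/-- The 4 axiom □p → □□p. -/
def axFour : Fml := ((Fml.var 0).box).imp ((Fml.var 0).box.box)

/-- The 4 axiom ◇◇p → ◇p. -/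
def axFourDia : Fml := ((Fml.var 0).dia.dia).imp ((Fml.var 0).dia)

/-- IS4: the smallest super-FS logic containing □p → p, p → ◇p, □p → □□p and
◇◇p → ◇p. -/
def IS4 : Set Fml :=
  {φ | ∀ L : Set Fml, SuperFS L →
    axT ∈ L → axTdia ∈ L → axFour ∈ L → axFourDia ∈ L → φ ∈ L}

namespace SuperFS

variable {L : Set Fml} {Γ A B C : Fml}

/-- Membership in `L` is preserved under weakening by a premise. -/
theorem weaken_s9 (hL : SuperFS L) (Γ : Fml) (h : A ∈ L) : Γ.imp A ∈ L :=
  hL.mp _ _ (hL.ipc _ (.ax1 A Γ)) h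

theorem imp_mp_s9 (hL : SuperFS L) (h : Γ.imp (A.imp B) ∈ L) (h' : Γ.imp A ∈ L) : Γ.imp B ∈ L :=
  hL.mp _ _ (hL.mp _ _ (hL.ipc _ (.ax2 Γ A B)) h) h'

theorem imp_trans_s9 (hL : SuperFS L) (h : A.imp B ∈ L) (h' : B.imp C ∈ L) : A.imp C ∈ L :=
  hL.imp_mp_s9 (hL.weaken_s9 A h') h

theorem and_left (hL : SuperFS L) (A B : Fml) : (A.and B).imp A ∈ L := hL.ipc _ (.andE1 A B)

theorem and_right (hL : SuperFS L) (A B : Fml) : (A.and B).imp B ∈ L := hL.ipc _ (.andE2 A B)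

theorem imp_and (hL : SuperFS L) (h : Γ.imp A ∈ L) (h' : Γ.imp B ∈ L) : Γ.imp (A.and B) ∈ L :=
  hL.imp_mp_s9 (hL.imp_trans_s9 h (hL.ipc _ (.andI A B))) h'

/-- The deduction theorem. -/
theorem deduction (hL : SuperFS L) (h : (Γ.and A).imp B ∈ L) : Γ.imp (A.imp B) ∈ L :=
  hL.imp_trans_s9 (hL.ipc _ (.andI Γ A))
    (hL.mp _ _ (hL.ipc _ (.ax2 A (Γ.and A) B)) (hL.weaken_s9 A h))

theorem imp_or_elim (hL : SuperFS L) (h : Γ.imp (A.or B) ∈ L) (hA : Γ.imp (A.imp C) ∈ L)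
    (hB : Γ.imp (B.imp C) ∈ L) : Γ.imp C ∈ L :=
  hL.imp_mp_s9 (hL.imp_mp_s9 (hL.imp_trans_s9 hA (hL.ipc _ (.orE A B C))) hB) h

theorem imp_chain_mem (hL : SuperFS L) (s a b r : Fml) :
    (s.imp a).imp ((a.imp (b.or r)).imp (s.imp ((s.and b).or r))) ∈ L := by
  apply hL.deduction
  apply hL.deduction
  set Γ := ((s.imp a).and (a.imp (b.or r))).and s
  have hs : Γ.imp s ∈ L := hL.and_right _ _
  have h1 : Γ.imp (s.imp a) ∈ L := hL.imp_trans_s9 (hL.and_left _ _) (hL.and_left _ _)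
  have h2 : Γ.imp (a.imp (b.or r)) ∈ L := hL.imp_trans_s9 (hL.and_left _ _) (hL.and_right _ _)
  refine hL.imp_or_elim (hL.imp_mp_s9 h2 (hL.imp_mp_s9 h1 hs)) (hL.deduction ?_)
    (hL.weaken_s9 _ (hL.ipc _ (.orI2 _ _)))
  exact hL.imp_trans_s9
    (hL.imp_and (hL.imp_trans_s9 (hL.and_left _ _) hs) (hL.and_right _ _))
    (hL.ipc _ (.orI1 _ _))

theorem box_dia_imp_mem (hL : SuperFS L) (s a b c r : Fml) :
    (((s.imp a).box.and s.dia).and ((s.and b).dia.imp c)).imp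
      ((a.imp (b.or r)).box.imp (r.dia.or c)) ∈ L := by
  apply hL.deduction
  set φ := ((s.imp a).box.and s.dia).and ((s.and b).dia.imp c)
  set Γ := φ.and (a.imp (b.or r)).box
  have hφ : Γ.imp φ ∈ L := hL.and_left _ _
  have h12 : Γ.imp ((s.imp a).box.and s.dia) ∈ L := hL.imp_trans_s9 hφ (hL.and_left _ _)
  have h1 : Γ.imp (s.imp a).box ∈ L := hL.imp_trans_s9 h12 (hL.and_left _ _)
  have h2 : Γ.imp s.dia ∈ L := hL.imp_trans_s9 h12 (hL.and_right _ _)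
  have h3 : Γ.imp ((s.and b).dia.imp c) ∈ L := hL.imp_trans_s9 hφ (hL.and_right _ _)
  have h4 : Γ.imp (a.imp (b.or r)).box ∈ L := hL.and_right _ _
  have hbox : Γ.imp (s.imp ((s.and b).or r)).box ∈ L :=
    hL.imp_mp_s9 (hL.imp_trans_s9 (hL.imp_trans_s9 h1
      (hL.mp _ _ (hL.axK _ _) (hL.nec _ (hL.imp_chain_mem s a b r)))) (hL.axK _ _)) h4
  have hdia : Γ.imp ((s.and b).or r).dia ∈ L :=
    hL.imp_mp_s9 (hL.imp_trans_s9 hbox (hL.axKdia _ _)) h2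
  refine hL.imp_or_elim (hL.imp_trans_s9 hdia (hL.axDiaOr _ _)) ?_
    (hL.weaken_s9 _ (hL.ipc _ (.orI1 _ _)))
  exact hL.deduction (hL.imp_trans_s9
    (hL.imp_mp_s9 (hL.imp_trans_s9 (hL.and_left _ _) h3) (hL.and_right _ _)) (hL.ipc _ (.orI2 _ _)))

end SuperFS

/-- Birelational Kripke frames for IS4. -/
structure IS4Frame where
  World : Type
  le : World → World → Prop
  R : World → World → Prop
  le_refl : ∀ w, le w w
  le_trans : ∀ u v w, le u v → le v w → le u w
  R_refl : ∀ w, R w w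
  R_trans : ∀ u v w, R u v → R v w → R u w
  forward : ∀ u u' v, le u u' → R u v → ∃ v', R u' v' ∧ le v v'
  backward : ∀ u v v', R u v → le v v' → ∃ u', le u u' ∧ R u' v'

namespace IS4Frame

/-- Forcing at a world under a valuation. -/
def Forces (F : IS4Frame) (V : ℕ → F.World → Prop) : Fml → F.World → Prop
  | .var n, w => V n w
  | .top, _ => True
  | .bot, _ => False
  | .and φ ψ, w => F.Forces V φ w ∧ F.Forces V ψ w
  | .or φ ψ, w => F.Forces V φ w ∨ F.Forces V ψ w
  | .imp φ ψ, w => ∀ u, F.le w u → F.Forces V φ u → F.Forces V ψ u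
  | .box φ, w => ∀ u, F.le w u → ∀ v, F.R u v → F.Forces V φ v
  | .dia φ, w => ∃ v, F.R w v ∧ F.Forces V φ v

/-- Upward closed valuations. -/
def Persistent (F : IS4Frame) (V : ℕ → F.World → Prop) : Prop :=
  ∀ n u v, F.le u v → V n u → V n v

variable {F : IS4Frame} {V : ℕ → F.World → Prop}

theorem Forces.mono (hV : F.Persistent V) (φ : Fml) :
    ∀ {u v}, F.le u v → F.Forces V φ u → F.Forces V φ v := by
  induction φ with
  | var n => exact fun h => hV n _ _ h
  | top => exact fun _ h => h
  | bot => exact fun _ h => h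
  | and φ ψ h1 h2 => exact fun h => And.imp (h1 h) (h2 h)
  | or φ ψ h1 h2 => exact fun h => Or.imp (h1 h) (h2 h)
  | imp φ ψ => exact fun h hu w hw => hu w (F.le_trans _ _ _ h hw)
  | box φ => exact fun h hu w hw => hu w (F.le_trans _ _ _ h hw)
  | dia φ ih =>
    rintro u v h ⟨w, hw, hφ⟩
    obtain ⟨w', hw', hle⟩ := F.forward _ _ _ h hw
    exact ⟨w', hw', ih hle hφ⟩

theorem forces_subst (σ : ℕ → Fml) (φ : Fml) (w : F.World) :
    F.Forces V (φ.subst σ) w ↔ F.Forces (fun n => F.Forces V (σ n)) φ w := by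
  induction φ generalizing w <;> simp_all [Forces, Fml.subst]

theorem forces_of_ipc (hV : F.Persistent V) {φ : Fml} (h : IPC φ) (w : F.World) :
    F.Forces V φ w := by
  induction h generalizing w with
  | ax1 φ ψ => exact fun u _ hφ v huv _ => Forces.mono hV φ huv hφ
  | ax2 φ ψ χ =>
    exact fun u _ h v huv h' x hvx hφ =>
      h x (F.le_trans _ _ _ huv hvx) hφ x (F.le_refl x) (h' x hvx hφ)
  | andE1 φ ψ => exact fun _ _ h => h.1
  | andE2 φ ψ => exact fun _ _ h => h.2
  | andI φ ψ => exact fun _ _ hφ v huv hψ => ⟨Forces.mono hV φ huv hφ, hψ⟩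
  | orI1 φ ψ => exact fun _ _ h => Or.inl h
  | orI2 φ ψ => exact fun _ _ h => Or.inr h
  | orE φ ψ χ =>
    exact fun u _ h v huv h' x hvx hor =>
      hor.elim (h x (F.le_trans _ _ _ huv hvx)) (h' x hvx)
  | botE φ => exact fun _ _ h => h.elim
  | topI => exact trivial
  | mp φ ψ _ _ h h' => exact h w w (F.le_refl w) (h' w)

variable (F) in
/-- The formulas valid on a frame. -/
def logic : Set Fml := {φ | ∀ V, F.Persistent V → ∀ w, F.Forces V φ w}

theorem superFS_logic : SuperFS F.logic where
  ipc _ h _ hV := forces_of_ipc hV h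
  axK _ _ _ _ _ u _ h v huv h' x hvx y hxy :=
    h x (F.le_trans _ _ _ huv hvx) y hxy y (F.le_refl y) (h' x hvx y hxy)
  axKdia _ _ _ _ _ _ _ h v huv := fun ⟨y, hvy, hp⟩ =>
    ⟨y, hvy, h v huv y hvy y (F.le_refl y) hp⟩
  axDiaOr _ _ _ _ _ _ _ := fun ⟨y, hy, h⟩ =>
    h.imp (fun h => ⟨y, hy, h⟩) (fun h => ⟨y, hy, h⟩)
  axFS _ _ _ _ _ u _ h v huv y hvy z hyz hp := by
    obtain ⟨v', hv', hz⟩ := F.backward _ _ _ hvy hyz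
    exact h v' (F.le_trans _ _ _ huv hv') ⟨z, hz, hp⟩ v' (F.le_refl v') z hz
  axDiaBot _ _ _ _ _ := fun ⟨_, _, h⟩ => h
  subst φ h σ V hV w :=
    (forces_subst σ φ w).2 (h _ (fun n _ _ => Forces.mono hV (σ n)) w)
  mp _ _ h h' V hV w := h V hV w w (F.le_refl w) (h' V hV w)
  nec _ h V hV _ _ _ v _ := h V hV v

/-- Soundness of IS4. -/
theorem forces_of_mem_IS4 (hV : F.Persistent V) {φ : Fml} (h : φ ∈ IS4) (w : F.World) :
    F.Forces V φ w := by
  refine h F.logic superFS_logic ?_ ?_ ?_ ?_ V hV w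
  · exact fun _ _ _ u _ h => h u (F.le_refl u) u (F.R_refl u)
  · exact fun _ _ _ u _ h => ⟨u, F.R_refl u, h⟩
  · intro _ _ _ u _ h v huv y hvy z hyz t hzt
    obtain ⟨v', hv', hz⟩ := F.backward _ _ _ hvy hyz
    exact h v' (F.le_trans _ _ _ huv hv') t (F.R_trans _ _ _ hz hzt)
  · exact fun _ _ _ u _ ⟨y, huy, z, hyz, h⟩ => ⟨z, F.R_trans _ _ _ huy hyz, h⟩

/-- The upper sets of a six-point order generated by `0 ≤ 1 ≤ 2`, `3 ≤ 5`, `4 ≤ 5`. -/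
def sixPointUp : Fin 6 → Finset (Fin 6) :=
  ![{0, 1, 2}, {1, 2}, {2}, {3, 5}, {4, 5}, {5}]

/-- The successors in the reflexive closure of `0 R 4`, `1 R 3`, `1 R 4`, `2 R 5`. -/
def sixPointSucc : Fin 6 → Finset (Fin 6) :=
  ![{0, 4}, {1, 3, 4}, {2, 5}, {3}, {4}, {5}]

/-- The frame given by `sixPointUp` and `sixPointSucc`. -/
def sixPoint : IS4Frame where
  World := Fin 6
  le i j := j ∈ sixPointUp i
  R i j := j ∈ sixPointSucc i
  le_refl := by decide
  le_trans := by decide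
  R_refl := by decide
  R_trans := by decide
  forward := by decide
  backward := by decide

/-- The set of worlds of `sixPoint` at which a variable is true. -/
def sixPointSet : ℕ → Finset (Fin 6)
  | 0 => {3, 4, 5}
  | 1 => {4, 5}
  | 2 => {2}
  | 3 => {3, 5}
  | 4 => {3, 5}
  | _ => ∅

/-- The valuation on `sixPoint` given by `sixPointSet`. -/
def sixPointVal (n : ℕ) (w : sixPoint.World) : Prop := w ∈ sixPointSet n

theorem sixPointVal_persistent : sixPoint.Persistent sixPointVal := by
  intro n
  match n with
  | 0 | 1 | 2 | 3 | 4 => unfold sixPointVal sixPoint; decide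
  | _ + 5 => exact fun _ _ _ h => absurd h (Finset.notMem_empty _)

/-- Forcing in the six-point model. -/
def SixForces (φ : Fml) (i : Fin 6) : Prop := sixPoint.Forces sixPointVal φ i

section SixForces

variable (φ ψ : Fml) (i : Fin 6)

theorem sixForces_var (n : ℕ) : SixForces (.var n) i ↔ i ∈ sixPointSet n := Iff.rfl

theorem sixForces_top : SixForces .top i ↔ True := Iff.rfl

theorem sixForces_bot : SixForces .bot i ↔ False := Iff.rfl

theorem sixForces_and : SixForces (φ.and ψ) i ↔ SixForces φ i ∧ SixForces ψ i := Iff.rfl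

theorem sixForces_or : SixForces (φ.or ψ) i ↔ SixForces φ i ∨ SixForces ψ i := Iff.rfl

theorem sixForces_imp :
    SixForces (φ.imp ψ) i ↔ ∀ u ∈ sixPointUp i, SixForces φ u → SixForces ψ u := Iff.rfl

theorem sixForces_box :
    SixForces φ.box i ↔ ∀ u ∈ sixPointUp i, ∀ v ∈ sixPointSucc u, SixForces φ v := Iff.rfl

theorem sixForces_dia : SixForces φ.dia i ↔ ∃ v ∈ sixPointSucc i, SixForces φ v := Iff.rfl

end SixForces

/-- Worlds `0`, `1` and worlds `4`, `5` agree on formulas in the first three variables. -/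
theorem sixForces_iff (χ : Fml) (hχ : χ.vars ⊆ {0, 1, 2}) :
    (SixForces χ 0 ↔ SixForces χ 1) ∧ (SixForces χ 4 ↔ SixForces χ 5) := by
  induction χ with
  | var n =>
    rcases hχ (Set.mem_singleton n) with rfl | rfl | rfl <;>
      simp only [sixForces_var] <;> decide
  | top => simp [sixForces_top]
  | bot => simp [sixForces_bot]
  | and φ ψ h1 h2 | or φ ψ h1 h2 | imp φ ψ h1 h2 =>
    obtain ⟨h1, h1'⟩ := h1 (Set.union_subset_iff.1 hχ).1
    obtain ⟨h2, h2'⟩ := h2 (Set.union_subset_iff.1 hχ).2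
    simp [sixForces_and, sixForces_or, sixForces_imp, sixPointUp, h1, h1', h2, h2']
  | box φ h =>
    obtain ⟨h, h'⟩ := h hχ
    simp [sixForces_box, sixPointUp, sixPointSucc, h, h']
    tauto
  | dia φ h =>
    have h35 : SixForces φ 3 → SixForces φ 5 :=
      Forces.mono sixPointVal_persistent φ (by unfold sixPoint; decide)
    obtain ⟨h, h'⟩ := h hχ
    simp [sixForces_dia, sixPointSucc, h, h']
    tauto

end IS4Frame

open IS4Frame

/-- IS4 does not have the Craig interpolation property. -/
theorem IS4_no_CIP : ¬ CIP IS4 := by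
  intro h
  obtain ⟨χ, hvars, h1, h2⟩ := h _ _ fun L hL _ _ _ _ =>
    hL.box_dia_imp_mem (.var 3) (.var 0) (.var 1) (.var 2) (.var 4)
  have hχ : χ.vars ⊆ {0, 1, 2} := by
    intro n hn
    have := hvars hn
    simp only [Fml.vars, Set.mem_inter_iff, Set.mem_union, Set.mem_singleton_iff] at this
    simp only [Set.mem_insert_iff, Set.mem_singleton_iff]
    omega
  have hφ : SixForces (.imp _ χ) 1 := forces_of_mem_IS4 sixPointVal_persistent h1 (1 : Fin 6)
  have hψ : SixForces (χ.imp _) 0 := forces_of_mem_IS4 sixPointVal_persistent h2 (0 : Fin 6)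
  rw [sixForces_imp] at hφ hψ
  have hχ1 : SixForces χ 1 := hφ 1 (by decide) (by
    simp only [sixForces_and, sixForces_imp, sixForces_box, sixForces_dia, sixForces_var]
    exact ⟨⟨by decide, by decide⟩, by decide⟩)
  have hψ0 := hψ 0 (by decide) ((sixForces_iff χ hχ).1.2 hχ1)
  revert hψ0
  simp only [sixForces_or, sixForces_imp, sixForces_box, sixForces_dia, sixForces_var]
  decide
end

section
/- The intuitionistic provability logic IGL, defined as the set of all L(□,◇)-formulas valid in every FS-frame (X, ≤, R) in which R is transitive and there is no infinite sequence x₀, x₁, x₂, … such that for every n there exists yₙ with xₙ ≤ yₙ and yₙ R xₙ₊₁, does not have the Craig interpolation property. -/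
/-- An FS-frame: a poset (le) with a binary relation R satisfying the
Fischer-Servi confluence conditions F1 and F2. -/
structure IsFSFrame {α : Type*} (le R : α → α → Prop) : Prop where
  refl : ∀ a, le a a
  trans : ∀ a b c, le a b → le b c → le a c
  antisymm : ∀ a b, le a b → le b a → a = b
  F1 : ∀ x x' y, le x x' → R x y → ∃ y', R x' y' ∧ le y y'
  F2 : ∀ x y y', R x y → le y y' → ∃ x', le x x' ∧ R x' y'

/-- An FS-morphism between FS-frames. -/
structure IsFSMorphism {α β : Type*} (leX RX : α → α → Prop)
    (leY RY : β → β → Prop) (f : α → β) : Prop where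
  mono : ∀ a b, leX a b → leY (f a) (f b)
  le_back : ∀ a z, leY (f a) z → ∃ a', leX a a' ∧ f a' = z
  forth : ∀ a b, RX a b → RY (f a) (f b)
  weak_back : ∀ a z, RY (f a) z → ∃ a', RX a a' ∧ leY z (f a')
  strong_back : ∀ a m z, leY (f a) m → RY m z →
    ∃ a' a'', leX a a' ∧ RX a' a'' ∧ leY (f a'') z


/-- Forcing in an FS-frame under a valuation. -/
def Force {α : Type*} (le R : α → α → Prop) (V : ℕ → Set α) : Fml → α → Prop
  | .var n, x => x ∈ V n
  | .top, _ => True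
  | .bot, _ => False
  | .and φ ψ, x => Force le R V φ x ∧ Force le R V ψ x
  | .or φ ψ, x => Force le R V φ x ∨ Force le R V ψ x
  | .imp φ ψ, x => ∀ y, le x y → Force le R V φ y → Force le R V ψ y
  | .box φ, x => ∀ y z, le x y → R y z → Force le R V φ z
  | .dia φ, x => ∃ y, R x y ∧ Force le R V φ y

/-- The logic IGL: all formulas valid in every FS-frame in which R is
transitive and there is no infinite sequence x₀, x₁, … such that for every n
there is yₙ with xₙ ≤ yₙ and yₙ R xₙ₊₁.  (Valuations assign upsets to the
propositional variables.) -/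
def IGL : Set Fml :=
  {φ | ∀ (α : Type) (le R : α → α → Prop), IsFSFrame le R →
    (∀ a b c, R a b → R b c → R a c) →
    (¬ ∃ x : ℕ → α, ∀ n : ℕ, ∃ y, le (x n) y ∧ R y (x (n + 1))) →
    ∀ V : ℕ → Set α, (∀ n, ∀ a ∈ V n, ∀ b, le a b → b ∈ V n) →
    ∀ x : α, Force le R V φ x}

/-- The partial order on five points with `0 < 1`, `2 < 3` and `4` isolated, shared by the two
countermodels. -/
def cmLe (i j : Fin 5) : Prop := i = j ∨ (i = 0 ∧ j = 1) ∨ (i = 2 ∧ j = 3)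

/-- The modal relation of the first countermodel. -/
def cmR₁ (i j : Fin 5) : Prop := (i = 0 ∧ (j = 2 ∨ j = 4)) ∨ (i = 1 ∧ (j = 2 ∨ j = 3 ∨ j = 4))

/-- The modal relation of the second countermodel. -/
def cmR₂ (i j : Fin 5) : Prop := (i = 0 ∧ j = 4) ∨ (i = 1 ∧ (j = 2 ∨ j = 3 ∨ j = 4))

instance : DecidableRel cmLe := fun i j => by unfold cmLe; infer_instance
instance : DecidableRel cmR₁ := fun i j => by unfold cmR₁; infer_instance
instance : DecidableRel cmR₂ := fun i j => by unfold cmR₂; infer_instance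

/-- The valuation of both countermodels. -/
def cmVal : ℕ → Set (Fin 5)
  | 0 => {2, 3}
  | 1 => {2, 3}
  | 2 => {3, 4}
  | 3 => {1}
  | _ => ∅

theorem cmVal_upset : ∀ n, ∀ a ∈ cmVal n, ∀ b, cmLe a b → b ∈ cmVal n := by
  intro n a ha b hab
  match n with
  | 0 | 1 | 2 | 3 => revert a b; simp only [cmVal, Set.mem_insert_iff, Set.mem_singleton_iff]; decide
  | _ + 4 => exact ha.elim

theorem isFSFrame_cmR₁ : IsFSFrame cmLe cmR₁ := by
  constructor <;> decide

theorem isFSFrame_cmR₂ : IsFSFrame cmLe cmR₂ := by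
  constructor <;> decide

/-- If no `le`-successor of an `R`-successor has an `R`-successor, then there is no infinite
`(le ; R)`-chain. -/
theorem no_chain {α : Type} {le R : α → α → Prop}
    (h : ∀ a b c d, R a b → le b c → ¬ R c d) :
    ¬ ∃ x : ℕ → α, ∀ n : ℕ, ∃ y, le (x n) y ∧ R y (x (n + 1)) := by
  rintro ⟨x, hx⟩
  obtain ⟨y, -, hy⟩ := hx 0
  obtain ⟨z, hz, hz'⟩ := hx 1
  exact h _ _ _ _ hy hz hz'

theorem force_cmR₁_of_mem {φ : Fml} (h : φ ∈ IGL) (i : Fin 5) : Force cmLe cmR₁ cmVal φ i :=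
  h _ _ _ isFSFrame_cmR₁ (by decide) (no_chain (by decide)) _ cmVal_upset i

theorem force_cmR₂_of_mem {φ : Fml} (h : φ ∈ IGL) (i : Fin 5) : Force cmLe cmR₂ cmVal φ i :=
  h _ _ _ isFSFrame_cmR₂ (by decide) (no_chain (by decide)) _ cmVal_upset i

/-- The two countermodels force the same formulas in the variables `2` and `3`. -/
theorem force_cm_iff (χ : Fml) (hχ : χ.vars ⊆ {2, 3}) :
    (∀ i, Force cmLe cmR₁ cmVal χ i ↔ Force cmLe cmR₂ cmVal χ i) ∧
      (Force cmLe cmR₁ cmVal χ 3 ↔ Force cmLe cmR₁ cmVal χ 4) ∧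
      (Force cmLe cmR₁ cmVal χ 2 → Force cmLe cmR₁ cmVal χ 3) := by
  induction χ with
  | var n =>
    have hn : n = 2 ∨ n = 3 := by simpa [Fml.vars] using hχ
    rcases hn with rfl | rfl <;> simp [Force, cmVal]
  | top => simp [Force]
  | bot => simp [Force]
  | and φ ψ ihφ ihψ | or φ ψ ihφ ihψ =>
    obtain ⟨hφ, hψ⟩ := Set.union_subset_iff.1 hχ
    obtain ⟨a, b, c⟩ := ihφ hφ
    obtain ⟨a', b', c'⟩ := ihψ hψ
    refine ⟨fun i => by simp only [Force, a, a'], by simp only [Force, b, b'], ?_⟩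
    simp only [Force]
    tauto
  | imp φ ψ ihφ ihψ =>
    obtain ⟨hφ, hψ⟩ := Set.union_subset_iff.1 hχ
    obtain ⟨a, b, c⟩ := ihφ hφ
    obtain ⟨a', b', c'⟩ := ihψ hψ
    refine ⟨fun i => by simp only [Force, a, a'], ?_, ?_⟩
    · simp [Force, cmLe, b, b']
    · simp [Force, Fin.forall_fin_succ, cmLe]
  | box φ ih =>
    obtain ⟨a, b, c⟩ := ih hχ
    simp only [Force, a, Fin.forall_fin_succ, cmLe, cmR₁, cmR₂] at *
    simp at *
    tauto
  | dia φ ih =>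
    obtain ⟨a, b, c⟩ := ih hχ
    simp only [Force, a, Fin.forall_fin_succ, Fin.exists_fin_succ, cmR₁, cmR₂] at *
    simp at *
    tauto

/-- `◇a ∧ (◇(a ∧ c) → e)` with `a`, `c`, `e` the variables `0`, `2`, `3`. -/
def cmAnte : Fml :=
  .and (.dia (.var 0)) (.imp (.dia (.and (.var 0) (.var 2))) (.var 3))

/-- `□(c ∨ b) ∧ (◇b → e) → e` with `b`, `c`, `e` the variables `1`, `2`, `3`. -/
def cmCons : Fml :=
  .imp (.and (.box (.or (.var 2) (.var 1))) (.imp (.dia (.var 1)) (.var 3))) (.var 3)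

theorem cmAnte_imp_cmCons_mem : cmAnte.imp cmCons ∈ IGL := by
  intro α le R hF _ _ V hV x y _ hy y' hyy' hy'
  obtain ⟨⟨z, hz, ha⟩, he⟩ := hy
  obtain ⟨hbox, hb⟩ := hy'
  obtain ⟨z', hz', hzz'⟩ := hF.F1 _ _ _ hyy' hz
  have ha' := hV 0 z ha z' hzz'
  rcases hbox y' z' (hF.refl _) hz' with hc | hb'
  · exact he y' hyy' ⟨z', hz', ha', hc⟩
  · exact hb y' (hF.refl _) ⟨z', hz', hb'⟩

theorem force_cmAnte : Force cmLe cmR₁ cmVal cmAnte 0 := by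
  simp only [cmAnte, Force, cmVal, Set.mem_insert_iff, Set.mem_singleton_iff]
  decide

theorem not_force_cmCons : ¬ Force cmLe cmR₂ cmVal cmCons 0 := by
  simp only [cmCons, Force, cmVal, Set.mem_insert_iff, Set.mem_singleton_iff]
  decide

theorem cmAnte_vars_inter_cmCons_vars : cmAnte.vars ∩ cmCons.vars ⊆ {2, 3} := by
  intro n
  simp only [cmAnte, cmCons, Fml.vars, Set.mem_inter_iff, Set.mem_union, Set.mem_singleton_iff,
    Set.mem_insert_iff]
  omega

/-- IGL does not have the Craig interpolation property. -/
theorem IGL_no_CIP : ¬ CIP IGL := by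
  intro h
  obtain ⟨χ, hv, h₁, h₂⟩ := h _ _ cmAnte_imp_cmCons_mem
  have hχ := force_cmR₁_of_mem h₁ 0 0 (isFSFrame_cmR₁.refl 0) force_cmAnte
  rw [(force_cm_iff χ (hv.trans cmAnte_vars_inter_cmCons_vars)).1] at hχ
  exact not_force_cmCons (force_cmR₂_of_mem h₂ 0 0 (isFSFrame_cmR₂.refl 0) hχ)
end

section
/- Let (X, ≤, R_X) and (Z, ≤, R_Z) be FS-frames, and let X^r and Z^r denote the frames obtained by replacing R_X and R_Z with their reflexive closures R_X ∪ {(x,x) : x ∈ X} and R_Z ∪ {(z,z) : z ∈ Z}. Then X^r and Z^r are FS-frames, and every FS-morphism f : X → Z is also an FS-morphism f : X^r → Z^r. -/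
/-- The reflexive closure of a relation. -/
def reflCl {α : Type*} (R : α → α → Prop) : α → α → Prop :=
  fun a b => R a b ∨ a = b

theorem IsFSFrame.reflCl {α : Type*} {le R : α → α → Prop} (h : IsFSFrame le R) :
    IsFSFrame le (reflCl R) where
  refl := h.refl
  trans := h.trans
  antisymm := h.antisymm
  F1 := by
    rintro x x' y hx (hR | rfl)
    · obtain ⟨y', hR', hy⟩ := h.F1 x x' y hx hR
      exact ⟨y', .inl hR', hy⟩
    · exact ⟨x', .inr rfl, hx⟩
  F2 := by
    rintro x y y' (hR | rfl) hy
    · obtain ⟨x', hx, hR'⟩ := h.F2 x y y' hR hy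
      exact ⟨x', hx, .inl hR'⟩
    · exact ⟨y', hy, .inr rfl⟩

theorem IsFSMorphism.reflCl {α β : Type*} {leX RX : α → α → Prop} {leZ RZ : β → β → Prop}
    {f : α → β} (hle : ∀ z, leZ z z) (h : IsFSMorphism leX RX leZ RZ f) :
    IsFSMorphism leX (reflCl RX) leZ (reflCl RZ) f where
  mono := h.mono
  le_back := h.le_back
  forth := fun a b hR => hR.imp (h.forth a b) (congrArg f)
  weak_back := by
    rintro a z (hR | rfl)
    · obtain ⟨a', hR', hz⟩ := h.weak_back a z hR
      exact ⟨a', .inl hR', hz⟩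
    · exact ⟨a, .inr rfl, hle _⟩
  strong_back := by
    rintro a m z hm (hR | rfl)
    · obtain ⟨a', a'', ha, hR', hz⟩ := h.strong_back a m z hm hR
      exact ⟨a', a'', ha, .inl hR', hz⟩
    · obtain ⟨a', ha, rfl⟩ := h.le_back a m hm
      exact ⟨a', a', ha, .inr rfl, hle _⟩

/-- replacing R by its reflexive closure in FS-frames X and Z
again yields FS-frames, and every FS-morphism f : X → Z is also an
FS-morphism between the resulting frames Xʳ and Zʳ. -/
theorem reflexive_closure_FS {α β : Type*}
    (leX RX : α → α → Prop) (leZ RZ : β → β → Prop)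
    (hX : IsFSFrame leX RX) (hZ : IsFSFrame leZ RZ) :
    IsFSFrame leX (reflCl RX) ∧ IsFSFrame leZ (reflCl RZ) ∧
    (∀ f : α → β, IsFSMorphism leX RX leZ RZ f →
      IsFSMorphism leX (reflCl RX) leZ (reflCl RZ) f) :=
  ⟨hX.reflCl, hZ.reflCl, fun _ hf => hf.reflCl hZ.refl⟩
end

section
/- Let (X, ≤, R) be an iK-frame. Then R is transitive if and only if for every upset U of X, □_R U ⊆ □_R (□_R U), where □_R U = {x ∈ X : for all y, x R y implies y ∈ U}. -/
/-- An iK-frame: a poset with a binary relation R satisfying the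
compatibility condition R = ≤ ∘ R ∘ ≤. -/
structure IsIKFrame {α : Type*} (le R : α → α → Prop) : Prop where
  refl : ∀ a, le a a
  trans : ∀ a b c, le a b → le b c → le a c
  antisymm : ∀ a b, le a b → le b a → a = b
  compat : ∀ x y, R x y ↔ ∃ u v, le x u ∧ R u v ∧ le v y


/-- in an iK-frame, R is transitive iff
□_R U ⊆ □_R (□_R U) for every upset U. -/
theorem transitive_iff_box_le_box_box {α : Type*} (le R : α → α → Prop)
    (h : IsIKFrame le R) :
    (∀ x y z, R x y → R y z → R x z) ↔
      ∀ U : Set α, (∀ a ∈ U, ∀ b, le a b → b ∈ U) →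
        {x | ∀ y, R x y → y ∈ U} ⊆
          {x | ∀ y, R x y → y ∈ {w | ∀ v, R w v → v ∈ U}} := by
  constructor
  · intro hR U _ x hx y hxy v hyv
    exact hx v (hR x y v hxy hyv)
  · intro hU x y z hxy hyz
    exact hU {w | R x w}
      (fun a ha b hab => (h.compat x b).2 ⟨x, a, h.refl x, ha, hab⟩)
      (fun _ hw => hw) y hxy z hyz
end

section
/- Let X, Y₁, Y₂ be iK-frames and let f : Y₁ → X and g : Y₂ → X be surjective iK-morphisms. Equip the pullback Pb(f,g) = {(y₁,y₂) ∈ Y₁ × Y₂ : f(y₁) = g(y₂)} with the componentwise order and componentwise relation R. Then: (1) Pb(f,g) is an iK-frame; (2) the projections π₁ : Pb(f,g) → Y₁ and π₂ : Pb(f,g) → Y₂ are surjective iK-morphisms; (3) f ∘ π₁ = g ∘ π₂; (4) if R is reflexive (respectively, transitive) on each of X, Y₁, Y₂, then R is reflexive (respectively, transitive) on Pb(f,g). -/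
/-- An iK-morphism between iK-frames. -/
structure IsIKMorphism {α β : Type*} (leX RX : α → α → Prop)
    (leY RY : β → β → Prop) (f : α → β) : Prop where
  mono : ∀ a b, leX a b → leY (f a) (f b)
  le_back : ∀ a z, leY (f a) z → ∃ a', leX a a' ∧ f a' = z
  forth : ∀ a b, RX a b → RY (f a) (f b)
  back : ∀ a b, RY (f a) b → ∃ b', RX a b' ∧ f b' = b

section Pullback

variable {X Y₁ Y₂ : Type*} (f : Y₁ → X) (g : Y₂ → X)

/-- The pullback of f and g. -/
def Pb : Type _ := {p : Y₁ × Y₂ // f p.1 = g p.2}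

/-- The componentwise order on the pullback. -/
def PbLe (le₁ : Y₁ → Y₁ → Prop) (le₂ : Y₂ → Y₂ → Prop) :
    Pb f g → Pb f g → Prop :=
  fun p q => le₁ p.1.1 q.1.1 ∧ le₂ p.1.2 q.1.2

/-- The componentwise relation on the pullback. -/
def PbR (R₁ : Y₁ → Y₁ → Prop) (R₂ : Y₂ → Y₂ → Prop) :
    Pb f g → Pb f g → Prop :=
  fun p q => R₁ p.1.1 q.1.1 ∧ R₂ p.1.2 q.1.2

end Pullback

/-- the pullback of surjective iK-morphisms, with componentwise
order and relation, is an iK-frame; the projections are surjective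
iK-morphisms commuting with f and g; and reflexivity (resp. transitivity) of
R is inherited by the pullback. -/
theorem pullback_iK {X Y₁ Y₂ : Type*}
    (leX RX : X → X → Prop) (le₁ R₁ : Y₁ → Y₁ → Prop) (le₂ R₂ : Y₂ → Y₂ → Prop)
    (hX : IsIKFrame leX RX) (h₁ : IsIKFrame le₁ R₁) (h₂ : IsIKFrame le₂ R₂)
    (f : Y₁ → X) (g : Y₂ → X)
    (hf : IsIKMorphism le₁ R₁ leX RX f) (hg : IsIKMorphism le₂ R₂ leX RX g)
    (sf : Function.Surjective f) (sg : Function.Surjective g) :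
    IsIKFrame (PbLe f g le₁ le₂) (PbR f g R₁ R₂) ∧
    IsIKMorphism (PbLe f g le₁ le₂) (PbR f g R₁ R₂) le₁ R₁
      (fun p : Pb f g => p.1.1) ∧
    Function.Surjective (fun p : Pb f g => p.1.1) ∧
    IsIKMorphism (PbLe f g le₁ le₂) (PbR f g R₁ R₂) le₂ R₂
      (fun p : Pb f g => p.1.2) ∧
    Function.Surjective (fun p : Pb f g => p.1.2) ∧
    (∀ p : Pb f g, f p.1.1 = g p.1.2) ∧
    (((∀ x, RX x x) ∧ (∀ y, R₁ y y) ∧ (∀ y, R₂ y y)) →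
      ∀ p : Pb f g, PbR f g R₁ R₂ p p) ∧
    (((∀ a b c, RX a b → RX b c → RX a c) ∧
      (∀ a b c, R₁ a b → R₁ b c → R₁ a c) ∧
      (∀ a b c, R₂ a b → R₂ b c → R₂ a c)) →
      ∀ p q r : Pb f g, PbR f g R₁ R₂ p q → PbR f g R₁ R₂ q r →
        PbR f g R₁ R₂ p r) := by
  refine ⟨⟨fun p => ⟨h₁.refl _, h₂.refl _⟩,
      fun p q r hpq hqr => ⟨h₁.trans _ _ _ hpq.1 hqr.1, h₂.trans _ _ _ hpq.2 hqr.2⟩,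
      fun p q hpq hqp => Subtype.ext (Prod.ext (h₁.antisymm _ _ hpq.1 hqp.1)
        (h₂.antisymm _ _ hpq.2 hqp.2)),
      fun p q => ⟨fun h => ⟨p, q, ⟨h₁.refl _, h₂.refl _⟩, h, h₁.refl _, h₂.refl _⟩, ?_⟩⟩,
    ⟨fun _ _ h => h.1, ?_, fun _ _ h => h.1, ?_⟩, ?_,
    ⟨fun _ _ h => h.2, ?_, fun _ _ h => h.2, ?_⟩, ?_, fun p => p.2,
    fun h p => ⟨h.2.1 _, h.2.2 _⟩,
    fun h p q r hpq hqr => ⟨h.2.1 _ _ _ hpq.1 hqr.1, h.2.2 _ _ _ hpq.2 hqr.2⟩⟩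
  · rintro ⟨u, v, hu, huv, hv⟩
    exact ⟨(h₁.compat _ _).2 ⟨_, _, hu.1, huv.1, hv.1⟩,
      (h₂.compat _ _).2 ⟨_, _, hu.2, huv.2, hv.2⟩⟩
  · rintro ⟨⟨a, b⟩, hab : f a = g b⟩ z (hz : le₁ a z)
    obtain ⟨b', hb, hb'⟩ := hg.le_back b (f z) (hab ▸ hf.mono _ _ hz)
    exact ⟨⟨(z, b'), hb'.symm⟩, ⟨hz, hb⟩, rfl⟩
  · rintro ⟨⟨a, b⟩, hab : f a = g b⟩ z (hz : R₁ a z)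
    obtain ⟨b', hb, hb'⟩ := hg.back b (f z) (hab ▸ hf.forth _ _ hz)
    exact ⟨⟨(z, b'), hb'.symm⟩, ⟨hz, hb⟩, rfl⟩
  · intro a
    obtain ⟨b, hb⟩ := sg (f a)
    exact ⟨⟨(a, b), hb.symm⟩, rfl⟩
  · rintro ⟨⟨a, b⟩, hab : f a = g b⟩ z (hz : le₂ b z)
    obtain ⟨a', ha, ha'⟩ := hf.le_back a (g z) (hab ▸ hg.mono _ _ hz)
    exact ⟨⟨(a', z), ha'⟩, ⟨ha, hz⟩, rfl⟩
  · rintro ⟨⟨a, b⟩, hab : f a = g b⟩ z (hz : R₂ b z)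
    obtain ⟨a', ha, ha'⟩ := hf.back a (g z) (hab ▸ hg.forth _ _ hz)
    exact ⟨⟨(a', z), ha'⟩, ⟨ha, hz⟩, rfl⟩
  · intro b
    obtain ⟨a, ha⟩ := sf (g b)
    exact ⟨⟨(a, b), ha⟩, rfl⟩
end

section
/- The intuitionistic modal logic iT, defined as the smallest set of L(□)-formulas containing all theorems of IPC, the axioms □(p∧q) ↔ (□p ∧ □q), □⊤, and □p → p, and closed under uniform substitution, modus ponens, and necessitation, has the Craig interpolation property. -/
/-- Formulas of the language L(□). -/
inductive Fml0 : Type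
  | var : ℕ → Fml0
  | top : Fml0
  | bot : Fml0
  | and : Fml0 → Fml0 → Fml0
  | or : Fml0 → Fml0 → Fml0
  | imp : Fml0 → Fml0 → Fml0
  | box : Fml0 → Fml0

/-- Biconditional, as an abbreviation. -/
def Fml0.iff (φ ψ : Fml0) : Fml0 := (φ.imp ψ).and (ψ.imp φ)

/-- Uniform substitution. -/
def Fml0.subst (σ : ℕ → Fml0) : Fml0 → Fml0
  | .var n => σ n
  | .top => .top
  | .bot => .bot
  | .and φ ψ => .and (φ.subst σ) (ψ.subst σ)
  | .or φ ψ => .or (φ.subst σ) (ψ.subst σ)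
  | .imp φ ψ => .imp (φ.subst σ) (ψ.subst σ)
  | .box φ => .box (φ.subst σ)

/-- The set of propositional variables occurring in a formula. -/
def Fml0.vars : Fml0 → Set ℕ
  | .var n => {n}
  | .top => ∅
  | .bot => ∅
  | .and φ ψ => φ.vars ∪ ψ.vars
  | .or φ ψ => φ.vars ∪ ψ.vars
  | .imp φ ψ => φ.vars ∪ ψ.vars
  | .box φ => φ.vars

/-- Theorems of the intuitionistic propositional calculus (in the language
L(□)), given by a standard Hilbert-style axiomatization; the axiom schemes
range over all formulas, so the set is closed under substitution. -/
inductive IPC0 : Fml0 → Prop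
  | ax1 (φ ψ : Fml0) : IPC0 (φ.imp (ψ.imp φ))
  | ax2 (φ ψ χ : Fml0) : IPC0 ((φ.imp (ψ.imp χ)).imp ((φ.imp ψ).imp (φ.imp χ)))
  | andE1 (φ ψ : Fml0) : IPC0 ((φ.and ψ).imp φ)
  | andE2 (φ ψ : Fml0) : IPC0 ((φ.and ψ).imp ψ)
  | andI (φ ψ : Fml0) : IPC0 (φ.imp (ψ.imp (φ.and ψ)))
  | orI1 (φ ψ : Fml0) : IPC0 (φ.imp (φ.or ψ))
  | orI2 (φ ψ : Fml0) : IPC0 (ψ.imp (φ.or ψ))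
  | orE (φ ψ χ : Fml0) : IPC0 ((φ.imp χ).imp ((ψ.imp χ).imp ((φ.or ψ).imp χ)))
  | botE (φ : Fml0) : IPC0 (Fml0.bot.imp φ)
  | topI : IPC0 Fml0.top
  | mp (φ ψ : Fml0) : IPC0 (φ.imp ψ) → IPC0 φ → IPC0 ψ

/-- `BoxLogic Ax L`: L contains all theorems of IPC, the normality axioms
□(p∧q) ↔ (□p ∧ □q) and □⊤, and the extra axioms Ax, and is closed under
uniform substitution, modus ponens and necessitation. -/
structure BoxLogic (Ax : Set Fml0) (L : Set Fml0) : Prop where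
  ipc : ∀ φ : Fml0, IPC0 φ → φ ∈ L
  norm_and : Fml0.iff (((Fml0.var 0).and (Fml0.var 1)).box)
    (((Fml0.var 0).box).and ((Fml0.var 1).box)) ∈ L
  norm_top : Fml0.top.box ∈ L
  ax : Ax ⊆ L
  subst : ∀ φ ∈ L, ∀ σ : ℕ → Fml0, φ.subst σ ∈ L
  mp : ∀ φ ψ : Fml0, φ.imp ψ ∈ L → φ ∈ L → ψ ∈ L
  nec : ∀ φ ∈ L, φ.box ∈ L

/-- The smallest logic in the language L(□) with the given extra axioms. -/
def smallestBoxLogic (Ax : Set Fml0) : Set Fml0 :=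
  {φ | ∀ L : Set Fml0, BoxLogic Ax L → φ ∈ L}

/-- The T axiom □p → p. -/
def axT0 : Fml0 := ((Fml0.var 0).box).imp (Fml0.var 0)

/-- The 4 axiom □p → □□p. -/
def axFour0 : Fml0 := ((Fml0.var 0).box).imp ((Fml0.var 0).box.box)

/-- The Craig interpolation property for sets of L(□)-formulas. -/
def CIP0 (L : Set Fml0) : Prop :=
  ∀ φ ψ : Fml0, φ.imp ψ ∈ L →
    ∃ χ : Fml0, χ.vars ⊆ φ.vars ∩ ψ.vars ∧ φ.imp χ ∈ L ∧ χ.imp ψ ∈ L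

/-- Schematic Hilbert-style presentation of iT, in which substitution is admissible. -/
inductive DerT : Fml0 → Prop
  | ipc (φ : Fml0) : IPC0 φ → DerT φ
  | boxAnd (φ ψ : Fml0) : DerT (Fml0.iff ((φ.and ψ).box) ((φ.box).and (ψ.box)))
  | boxTop : DerT Fml0.top.box
  | axT (φ : Fml0) : DerT ((φ.box).imp φ)
  | mp (φ ψ : Fml0) : DerT (φ.imp ψ) → DerT φ → DerT ψ
  | nec (φ : Fml0) : DerT φ → DerT φ.box

theorem IPC0.subst {φ : Fml0} (h : IPC0 φ) (σ : ℕ → Fml0) : IPC0 (φ.subst σ) := by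
  induction h with
  | ax1 => exact .ax1 _ _
  | ax2 => exact .ax2 _ _ _
  | andE1 => exact .andE1 _ _
  | andE2 => exact .andE2 _ _
  | andI => exact .andI _ _
  | orI1 => exact .orI1 _ _
  | orI2 => exact .orI2 _ _
  | orE => exact .orE _ _ _
  | botE => exact .botE _
  | topI => exact .topI
  | mp _ _ _ _ ih₁ ih₂ => exact .mp _ _ ih₁ ih₂

theorem DerT.subst {φ : Fml0} (h : DerT φ) (σ : ℕ → Fml0) : DerT (φ.subst σ) := by
  induction h with
  | ipc _ h => exact .ipc _ (h.subst σ)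
  | boxAnd => exact .boxAnd _ _
  | boxTop => exact .boxTop
  | axT => exact .axT _
  | mp _ _ _ _ ih₁ ih₂ => exact .mp _ _ ih₁ ih₂
  | nec _ _ ih => exact .nec _ ih

theorem boxLogic_derT : BoxLogic {axT0} {φ | DerT φ} where
  ipc _ h := .ipc _ h
  norm_and := .boxAnd _ _
  norm_top := .boxTop
  ax := by rintro _ rfl; exact .axT _
  subst _ h σ := DerT.subst h σ
  mp _ _ h₁ h₂ := .mp _ _ h₁ h₂
  nec _ h := .nec _ h

theorem BoxLogic.of_derT {L : Set Fml0} (hL : BoxLogic {axT0} L) {φ : Fml0} (h : DerT φ) :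
    φ ∈ L := by
  induction h with
  | ipc _ h => exact hL.ipc _ h
  | boxAnd φ ψ => exact hL.subst _ hL.norm_and fun n => if n = 0 then φ else ψ
  | boxTop => exact hL.norm_top
  | axT φ => exact hL.subst _ (hL.ax rfl) fun _ => φ
  | mp _ _ _ _ ih₁ ih₂ => exact hL.mp _ _ ih₁ ih₂
  | nec _ _ ih => exact hL.nec _ ih

theorem mem_smallestBoxLogic_axT0_iff {φ : Fml0} :
    φ ∈ smallestBoxLogic {axT0} ↔ DerT φ :=
  ⟨fun h => h _ boxLogic_derT, fun h _ hL => hL.of_derT h⟩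

/-- A set of formulas containing iT and closed under modus ponens. -/
structure ITheory (T : Set Fml0) : Prop where
  der : ∀ {φ}, DerT φ → φ ∈ T
  mp : ∀ {φ ψ : Fml0}, φ.imp ψ ∈ T → φ ∈ T → ψ ∈ T

namespace ITheory

variable {T S : Set Fml0}

theorem ipc (hT : ITheory T) {φ : Fml0} (h : IPC0 φ) : φ ∈ T := hT.der (.ipc _ h)

theorem weaken (hT : ITheory T) (a : Fml0) {x : Fml0} (h : x ∈ T) : a.imp x ∈ T :=
  hT.mp (hT.ipc (.ax1 _ _)) h

/-- The theory generated by `T` and a formula `a`, by the deduction theorem. -/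
theorem adjoin (hT : ITheory T) (a : Fml0) : ITheory {x | a.imp x ∈ T} where
  der h := hT.weaken a (hT.der h)
  mp h₁ h₂ := hT.mp (hT.mp (hT.ipc (.ax2 _ _ _)) h₁) h₂

theorem imp_self (hT : ITheory T) (a : Fml0) : a.imp a ∈ T :=
  hT.mp (hT.mp (hT.ipc (.ax2 _ (a.imp a) _)) (hT.ipc (.ax1 _ _))) (hT.ipc (.ax1 _ _))

theorem and_mem_iff (hT : ITheory T) {a b : Fml0} : a.and b ∈ T ↔ a ∈ T ∧ b ∈ T :=
  ⟨fun h => ⟨hT.mp (hT.ipc (.andE1 _ _)) h, hT.mp (hT.ipc (.andE2 _ _)) h⟩,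
    fun h => hT.mp (hT.mp (hT.ipc (.andI _ _)) h.1) h.2⟩

theorem box_and_mem_iff (hT : ITheory T) {a b : Fml0} :
    (a.and b).box ∈ T ↔ a.box ∈ T ∧ b.box ∈ T := by
  have h := hT.and_mem_iff.1 (hT.der (.boxAnd a b))
  rw [← hT.and_mem_iff]
  exact ⟨hT.mp h.1, hT.mp h.2⟩

/-- The theory generated by `T` and the formulas of `S` lying in a fragment closed under
conjunction. -/
theorem join (hT : ITheory T) (hS : ITheory S) {P : Fml0 → Prop} (hTop : P .top)
    (hAnd : ∀ a b, P a → P b → P (a.and b)) :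
    ITheory {x | ∃ s ∈ S, P s ∧ s.imp x ∈ T} where
  der h := ⟨.top, hS.ipc .topI, hTop, hT.weaken _ (hT.der h)⟩
  mp := by
    rintro x y ⟨s, hs, ps, h₁⟩ ⟨t, ht, pt, h₂⟩
    refine ⟨s.and t, hS.and_mem_iff.2 ⟨hs, ht⟩, hAnd _ _ ps pt, ?_⟩
    have hA := hT.adjoin (s.and t)
    have hst := hA.and_mem_iff.1 (hT.imp_self (s.and t))
    exact hA.mp (hA.mp (hT.weaken _ h₁) hst.1) (hA.mp (hT.weaken _ h₂) hst.2)

end ITheory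

/-- A consistent theory with the disjunction property. -/
structure IPrime (T : Set Fml0) : Prop extends ITheory T where
  bot : Fml0.bot ∉ T
  or : ∀ {a b : Fml0}, a.or b ∈ T → a ∈ T ∨ b ∈ T

theorem IPrime.or_mem_iff {T : Set Fml0} (hT : IPrime T) {a b : Fml0} :
    a.or b ∈ T ↔ a ∈ T ∨ b ∈ T := by
  refine ⟨hT.or, ?_⟩
  rintro (h | h)
  · exact hT.mp (hT.ipc (.orI1 _ _)) h
  · exact hT.mp (hT.ipc (.orI2 _ _)) h

/-- Prime theory theorem: a theory disjoint from a nonempty directed set extends to a prime one. -/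
theorem ITheory.exists_prime {T : Set Fml0} (hT : ITheory T) {D : Set Fml0} (hD : D.Nonempty)
    (hdir : ∀ a ∈ D, ∀ b ∈ D, ∃ c ∈ D, DerT (a.imp c) ∧ DerT (b.imp c))
    (hdisj : ∀ d ∈ D, d ∉ T) :
    ∃ S, T ⊆ S ∧ IPrime S ∧ ∀ d ∈ D, d ∉ S := by
  obtain ⟨M, hTM, hM⟩ := zorn_subset_nonempty {S | ITheory S ∧ ∀ d ∈ D, d ∉ S} (by
    intro c hc hchain ⟨S₀, hS₀⟩
    refine ⟨⋃₀ c, ⟨⟨fun h => ⟨S₀, hS₀, (hc hS₀).1.der h⟩, ?_⟩, ?_⟩,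
      fun s hs => Set.subset_sUnion_of_mem hs⟩
    · rintro φ ψ ⟨A, hA, h₁⟩ ⟨B, hB, h₂⟩
      rcases hchain.total hA hB with h | h
      · exact ⟨B, hB, (hc hB).1.mp (h h₁) h₂⟩
      · exact ⟨A, hA, (hc hA).1.mp h₁ (h h₂)⟩
    · rintro d hd ⟨A, hA, h⟩
      exact (hc hA).2 d hd h) T ⟨hT, hdisj⟩
  obtain ⟨hMT, hMD⟩ := hM.prop
  have key : ∀ a, a ∉ M → ∃ d ∈ D, a.imp d ∈ M := by
    intro a ha
    by_contra! hcon
    have hle : M ⊆ {x | a.imp x ∈ M} := fun x hx => hMT.weaken a hx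
    exact ha (hM.le_of_ge ⟨hMT.adjoin a, hcon⟩ hle (hMT.imp_self a))
  refine ⟨M, hTM, ⟨hMT, ?_, ?_⟩, hMD⟩
  · intro hbot
    obtain ⟨d, hd⟩ := hD
    exact hMD d hd (hMT.mp (hMT.ipc (.botE d)) hbot)
  · intro a b hab
    by_contra! hcon
    obtain ⟨d, hd, h₁⟩ := key a hcon.1
    obtain ⟨e, he, h₂⟩ := key b hcon.2
    obtain ⟨c, hc, hdc, hec⟩ := hdir d hd e he
    have h₃ : a.imp c ∈ M := (hMT.adjoin a).mp (hMT.weaken a (hMT.der hdc)) h₁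
    have h₄ : b.imp c ∈ M := (hMT.adjoin b).mp (hMT.weaken b (hMT.der hec)) h₂
    exact hMD c hc (hMT.mp (hMT.mp (hMT.mp (hMT.ipc (.orE a b c)) h₃) h₄) hab)

theorem ITheory.exists_prime_notMem {T : Set Fml0} (hT : ITheory T) {b : Fml0} (hb : b ∉ T) :
    ∃ S, T ⊆ S ∧ IPrime S ∧ b ∉ S := by
  have hDer : ITheory {φ | DerT φ} := ⟨id, DerT.mp _ _⟩
  obtain ⟨S, hTS, hS, h⟩ := hT.exists_prime (D := {b}) ⟨b, rfl⟩
    (by rintro _ rfl _ rfl; exact ⟨_, rfl, hDer.imp_self _, hDer.imp_self _⟩)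
    (by rintro _ rfl; exact hb)
  exact ⟨S, hTS, hS, h b rfl⟩

/-- The formula `φ` lies in the common language of the `V i`. -/
def IsCommon (V : Bool → Set ℕ) (φ : Fml0) : Prop := ∀ i, φ.vars ⊆ V i

section Amalgamation

variable {V : Bool → Set ℕ}

theorem isCommon_top : IsCommon V .top := fun _ => Set.empty_subset _

theorem isCommon_bot : IsCommon V .bot := fun _ => Set.empty_subset _

theorem IsCommon.union {a b c : Fml0} (hc : c.vars = a.vars ∪ b.vars) (ha : IsCommon V a)
    (hb : IsCommon V b) : IsCommon V c := fun i => hc ▸ Set.union_subset (ha i) (hb i)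

/-- If the common part of a theory `T` is contained in a prime theory `S`, then `T` extends to a
prime theory with the same common part as `S`. -/
theorem ITheory.exists_prime_amalgam {T S : Set Fml0} (hT : ITheory T) (hS : IPrime S)
    (h : ∀ c, IsCommon V c → c ∈ T → c ∈ S) :
    ∃ R, T ⊆ R ∧ IPrime R ∧ ∀ c, IsCommon V c → (c ∈ R ↔ c ∈ S) := by
  have hDer : ITheory {φ | DerT φ} := ⟨id, DerT.mp _ _⟩
  obtain ⟨R, hTR, hR, hRD⟩ := (hT.join hS.toITheory (P := IsCommon V) isCommon_top
      fun _ _ ha hb => ha.union rfl hb).exists_prime (D := {c | IsCommon V c ∧ c ∉ S})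
    ⟨.bot, isCommon_bot, hS.bot⟩
    (by
      rintro a ⟨ha, ha'⟩ b ⟨hb, hb'⟩
      refine ⟨a.or b, ⟨ha.union rfl hb, fun hab => ?_⟩, .ipc _ (.orI1 _ _), .ipc _ (.orI2 _ _)⟩
      exact (hS.or hab).elim ha' hb')
    (by
      rintro d ⟨hd, hd'⟩ ⟨s, hs, hsc, hsd⟩
      exact hd' (hS.mp (h _ (hsc.union rfl hd) hsd) hs))
  refine ⟨R, fun x hx => hTR ⟨.top, hS.ipc .topI, isCommon_top, hT.weaken _ hx⟩, hR,
    fun c hc => ⟨fun hcR => ?_, fun hcS => hTR ⟨c, hcS, hc, hT.imp_self c⟩⟩⟩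
  by_contra hcS
  exact hRD c ⟨hc, hcS⟩ hcR

end Amalgamation

/-- A pair of prime theories that agree on the common language. -/
structure PairWorld (V : Bool → Set ℕ) where
  th : Bool → Set Fml0
  prime : ∀ i, IPrime (th i)
  agree : ∀ c, IsCommon V c → ∀ i j, c ∈ th i → c ∈ th j

namespace PairWorld

variable {V : Bool → Set ℕ}

theorem exists_of_prime {S R : Set Fml0} (hS : IPrime S) (hR : IPrime R)
    (h : ∀ c, IsCommon V c → (c ∈ R ↔ c ∈ S)) (i : Bool) :
    ∃ w : PairWorld V, w.th i = S ∧ w.th (!i) = R := by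
  refine ⟨⟨fun j => if j = i then S else R, ?_, ?_⟩, by simp, by simp⟩
  · intro j; split_ifs <;> assumption
  · intro c hc j k; have := h c hc; split_ifs <;> tauto

/-- The box of a formula that is not a conjunction: `B` is the truth value of the formula. -/
def ForcesBox (φ : Fml0) (B : PairWorld V → Prop) (w : PairWorld V) : Prop :=
  (∃ i, φ.vars ⊆ V i ∧ φ.box ∈ w.th i) ∨ (DerT φ ∧ B w)

/-- The forcing relations of `φ` and of `φ.box`. The box need not respect equivalence of formulas:
it is only required to commute with conjunction. -/
def forcing : Fml0 → (PairWorld V → Prop) × (PairWorld V → Prop)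
  | .var n =>
    let F := fun w => ∃ i, n ∈ V i ∧ Fml0.var n ∈ w.th i
    (F, ForcesBox (.var n) F)
  | .top => (fun _ => True, ForcesBox .top fun _ => True)
  | .bot => (fun _ => False, ForcesBox .bot fun _ => False)
  | .and φ ψ =>
    (fun w => (forcing φ).1 w ∧ (forcing ψ).1 w, fun w => (forcing φ).2 w ∧ (forcing ψ).2 w)
  | .or φ ψ =>
    let F := fun w => (forcing φ).1 w ∨ (forcing ψ).1 w
    (F, ForcesBox (.or φ ψ) F)
  | .imp φ ψ =>
    let F := fun w => ∀ v : PairWorld V, (∀ i, w.th i ⊆ v.th i) →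
      (forcing φ).1 v → (forcing ψ).1 v
    (F, ForcesBox (.imp φ ψ) F)
  | .box φ => ((forcing φ).2, ForcesBox (.box φ) (forcing φ).2)

theorem ForcesBox.mono {φ : Fml0} {B : PairWorld V → Prop} {w v : PairWorld V}
    (hwv : ∀ i, w.th i ⊆ v.th i) (hB : B w → B v) (h : ForcesBox φ B w) : ForcesBox φ B v :=
  h.imp (fun ⟨i, h₁, h₂⟩ => ⟨i, h₁, hwv i h₂⟩) (fun h => ⟨h.1, hB h.2⟩)

theorem forcing_mono (φ : Fml0) {w v : PairWorld V} (hwv : ∀ i, w.th i ⊆ v.th i) :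
    ((forcing φ).1 w → (forcing φ).1 v) ∧ ((forcing φ).2 w → (forcing φ).2 v) := by
  have key : ∀ (χ : Fml0) (B : PairWorld V → Prop), (B w → B v) →
      (B w → B v) ∧ (ForcesBox χ B w → ForcesBox χ B v) :=
    fun χ B h => ⟨h, ForcesBox.mono hwv h⟩
  induction φ with
  | var n => exact key _ _ fun ⟨i, h₁, h₂⟩ => ⟨i, h₁, hwv i h₂⟩
  | top => exact key _ _ id
  | bot => exact key _ _ id
  | and φ ψ ih₁ ih₂ => exact ⟨And.imp ih₁.1 ih₂.1, And.imp ih₁.2 ih₂.2⟩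
  | or φ ψ ih₁ ih₂ => exact key _ _ (Or.imp ih₁.1 ih₂.1)
  | imp φ ψ => exact key _ _ fun h u hu => h u fun i => (hwv i).trans (hu i)
  | box φ ih => exact key _ _ ih.2

theorem forcesBox_iff {φ : Fml0} {B : PairWorld V → Prop} {w : PairWorld V} {i : Bool}
    (hφ : φ.vars ⊆ V i) : ForcesBox φ B w ↔ φ.box ∈ w.th i := by
  refine ⟨?_, fun h => .inl ⟨i, hφ, h⟩⟩
  rintro (⟨j, hj, h⟩ | ⟨h, -⟩)
  · by_cases hij : j = i
    · exact hij ▸ h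
    · refine w.agree _ (fun k => ?_) j i h
      have : k = i ∨ k = j := by cases i <;> cases j <;> cases k <;> simp_all
      rcases this with rfl | rfl
      exacts [hφ, hj]
  · exact (w.prime i).der (.nec _ h)

/-- Extension property behind the implication case of the truth lemma. -/
theorem exists_extension (w : PairWorld V) (i : Bool) {a b : Fml0} (h : a.imp b ∉ w.th i) :
    ∃ v : PairWorld V, (∀ j, w.th j ⊆ v.th j) ∧ a ∈ v.th i ∧ b ∉ v.th i := by
  have hwi := (w.prime i).toITheory
  obtain ⟨S, hsub, hS, hb⟩ := (hwi.adjoin a).exists_prime_notMem h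
  have hwS : w.th i ⊆ S := fun x hx => hsub (hwi.weaken a hx)
  obtain ⟨R, hR, hRp, hRS⟩ := (w.prime (!i)).toITheory.exists_prime_amalgam (V := V) hS
    fun c hc hcT => hwS (w.agree c hc _ _ hcT)
  obtain ⟨v, rfl, rfl⟩ := exists_of_prime hS hRp hRS i
  refine ⟨v, fun j => ?_, hsub (hwi.imp_self a), hb⟩
  rcases Bool.eq_or_eq_not j i with rfl | rfl
  exacts [hwS, hR]

/-- Truth lemma. -/
theorem forcing_iff (φ : Fml0) (i : Bool) (hφ : φ.vars ⊆ V i) (w : PairWorld V) :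
    ((forcing φ).1 w ↔ φ ∈ w.th i) ∧ ((forcing φ).2 w ↔ φ.box ∈ w.th i) := by
  induction φ generalizing w with
  | var n =>
    refine ⟨⟨?_, fun h => ⟨i, hφ rfl, h⟩⟩, forcesBox_iff (B := (forcing (.var n)).1) (w := w) hφ⟩
    rintro ⟨j, hj, h⟩
    by_cases hij : j = i
    · exact hij ▸ h
    · refine w.agree _ (fun k => ?_) j i h
      have : k = i ∨ k = j := by cases i <;> cases j <;> cases k <;> simp_all
      rcases this with rfl | rfl
      exacts [hφ, Set.singleton_subset_iff.2 hj]
  | top => exact ⟨iff_of_true trivial ((w.prime i).ipc .topI),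
      forcesBox_iff (B := (forcing .top).1) (w := w) hφ⟩
  | bot => exact ⟨iff_of_false id (w.prime i).bot,
      forcesBox_iff (B := (forcing .bot).1) (w := w) hφ⟩
  | and φ ψ ih₁ ih₂ =>
    obtain ⟨h₁, h₂⟩ := Set.union_subset_iff.1 hφ
    exact ⟨(and_congr (ih₁ h₁ w).1 (ih₂ h₂ w).1).trans (w.prime i).and_mem_iff.symm,
      (and_congr (ih₁ h₁ w).2 (ih₂ h₂ w).2).trans (w.prime i).box_and_mem_iff.symm⟩
  | or φ ψ ih₁ ih₂ =>
    obtain ⟨h₁, h₂⟩ := Set.union_subset_iff.1 hφ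
    exact ⟨(or_congr (ih₁ h₁ w).1 (ih₂ h₂ w).1).trans (w.prime i).or_mem_iff.symm,
      forcesBox_iff (B := (forcing (.or φ ψ)).1) (w := w) hφ⟩
  | imp φ ψ ih₁ ih₂ =>
    obtain ⟨h₁, h₂⟩ := Set.union_subset_iff.1 hφ
    refine ⟨⟨fun h => ?_, fun h v hv hφv => ?_⟩,
      forcesBox_iff (B := (forcing (.imp φ ψ)).1) (w := w) hφ⟩
    · by_contra hcon
      obtain ⟨v, hv, ha, hb⟩ := w.exists_extension i hcon
      exact hb ((ih₂ h₂ v).1.1 (h v hv ((ih₁ h₁ v).1.2 ha)))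
    · exact (ih₂ h₂ v).1.2 ((v.prime i).mp (hv i h) ((ih₁ h₁ v).1.1 hφv))
  | box φ ih => exact ⟨(ih hφ w).2, forcesBox_iff hφ⟩

theorem forcing_of_forcing_box (φ : Fml0) {w : PairWorld V} (h : (forcing φ).2 w) :
    (forcing φ).1 w := by
  have key : ∀ χ : Fml0, ForcesBox χ (forcing χ).1 w → (forcing χ).1 w := by
    rintro χ (⟨i, hi, h⟩ | ⟨-, h⟩)
    · exact (forcing_iff χ i hi w).1.2 ((w.prime i).mp ((w.prime i).der (.axT _)) h)
    · exact h
  induction φ with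
  | and φ ψ ih₁ ih₂ => exact ⟨ih₁ h.1, ih₂ h.2⟩
  | _ => exact key _ h

theorem forcing_box_of_derT (φ : Fml0) (hφ : DerT φ) {w : PairWorld V} (h : (forcing φ).1 w) :
    (forcing φ).2 w := by
  induction φ with
  | and φ ψ ih₁ ih₂ =>
    exact ⟨ih₁ (.mp _ _ (.ipc _ (.andE1 _ _)) hφ) h.1, ih₂ (.mp _ _ (.ipc _ (.andE2 _ _)) hφ) h.2⟩
  | _ => exact .inr ⟨hφ, h⟩

theorem forcing_of_ipc {φ : Fml0} (h : IPC0 φ) (w : PairWorld V) : (forcing φ).1 w := by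
  induction h generalizing w with
  | ax1 φ ψ => exact fun v _ h u hu _ => (forcing_mono φ hu).1 h
  | ax2 φ ψ χ =>
    exact fun v _ h u hu h' t ht hφ =>
      h t (fun i => (hu i).trans (ht i)) hφ t (fun _ => subset_rfl) (h' t ht hφ)
  | andE1 => exact fun _ _ h => h.1
  | andE2 => exact fun _ _ h => h.2
  | andI φ ψ => exact fun v _ h u hu h' => ⟨(forcing_mono φ hu).1 h, h'⟩
  | orI1 => exact fun _ _ h => .inl h
  | orI2 => exact fun _ _ h => .inr h
  | orE φ ψ χ =>
    exact fun v _ h u hu h' t ht hor =>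
      hor.elim (h t fun i => (hu i).trans (ht i)) (h' t ht)
  | botE => exact fun _ _ h => h.elim
  | topI => trivial
  | mp φ ψ _ _ ih₁ ih₂ => exact ih₁ w w (fun _ => subset_rfl) (ih₂ w)

theorem forcing_of_derT {φ : Fml0} (h : DerT φ) (w : PairWorld V) : (forcing φ).1 w := by
  induction h generalizing w with
  | ipc _ h => exact forcing_of_ipc h w
  | boxAnd φ ψ => exact ⟨fun _ _ h => h, fun _ _ h => h⟩
  | boxTop => exact .inr ⟨.ipc _ .topI, trivial⟩
  | axT φ => exact fun _ _ h => forcing_of_forcing_box φ h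
  | mp φ ψ _ _ ih₁ ih₂ => exact ih₁ w w (fun _ => subset_rfl) (ih₂ w)
  | nec φ h ih => exact forcing_box_of_derT φ h (ih w)

end PairWorld

/-- the logic iT = iK ⊕ (□p → p) has the Craig interpolation
property. -/
theorem iT_CIP : CIP0 (smallestBoxLogic {axT0}) := by
  intro φ ψ h
  simp only [mem_smallestBoxLogic_axT0_iff] at h ⊢
  by_contra! hno
  let V : Bool → Set ℕ := fun i => bif i then φ.vars else ψ.vars
  have hDer : ITheory {χ | DerT χ} := ⟨id, DerT.mp _ _⟩
  have hφ := hDer.adjoin φ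
  obtain ⟨S, hsub, hS, hψ⟩ := (hDer.join hφ (P := IsCommon V) isCommon_top
      fun _ _ ha hb => ha.union rfl hb).exists_prime_notMem (b := ψ) (by
    rintro ⟨s, hs, hsV, hsψ⟩
    exact hno s (Set.subset_inter (hsV true) (hsV false)) hs hsψ)
  obtain ⟨R, hR, hRp, hRS⟩ := hφ.exists_prime_amalgam (V := V) hS
    fun c hc hφc => hsub ⟨c, hφc, hc, hDer.imp_self c⟩
  obtain ⟨w, rfl, rfl⟩ := PairWorld.exists_of_prime hS hRp hRS false
  exact hψ ((PairWorld.forcing_iff ψ false subset_rfl w).1.1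
    (PairWorld.forcing_of_derT h w w (fun _ => subset_rfl)
      ((PairWorld.forcing_iff φ true subset_rfl w).1.2 (hR (hDer.imp_self φ)))))
end

section
/- The intuitionistic modal logic iK4, defined as the smallest set of L(□)-formulas containing all theorems of IPC, the axioms □(p∧q) ↔ (□p ∧ □q), □⊤, and □p → □□p, and closed under uniform substitution, modus ponens, and necessitation, has the Craig interpolation property. -/
namespace IK4Interpolation

open Fml0

/-! Necessitation and `□(p ∧ q) ↔ (□p ∧ □q)` alone do not make `□` congruential, so boxed formulas
are treated below as intuitionistic atoms subject to the modal axioms. -/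

theorem ipc_subst {φ : Fml0} (h : IPC0 φ) (σ : ℕ → Fml0) : IPC0 (φ.subst σ) := by
  induction h with
  | ax1 => exact .ax1 _ _
  | ax2 => exact .ax2 _ _ _
  | andE1 => exact .andE1 _ _
  | andE2 => exact .andE2 _ _
  | andI => exact .andI _ _
  | orI1 => exact .orI1 _ _
  | orI2 => exact .orI2 _ _
  | orE => exact .orE _ _ _
  | botE => exact .botE _
  | topI => exact .topI
  | mp _ _ _ _ h₁ h₂ => exact .mp _ _ h₁ h₂

/-- Schematic axiomatization of iK4, without a substitution rule. -/
inductive Thm : Fml0 → Prop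
  | ipc {φ : Fml0} : IPC0 φ → Thm φ
  | box_and (φ ψ : Fml0) : Thm (Fml0.iff (φ.and ψ).box (φ.box.and ψ.box))
  | box_top : Thm top.box
  | four (φ : Fml0) : Thm (φ.box.imp φ.box.box)
  | mp {φ ψ : Fml0} : Thm (φ.imp ψ) → Thm φ → Thm ψ
  | nec {φ : Fml0} : Thm φ → Thm φ.box

theorem thm_subst {φ : Fml0} (h : Thm φ) (σ : ℕ → Fml0) : Thm (φ.subst σ) := by
  induction h with
  | ipc h => exact .ipc (ipc_subst h σ)
  | box_and => exact .box_and _ _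
  | box_top => exact .box_top
  | four => exact .four _
  | mp _ _ h₁ h₂ => exact .mp h₁ h₂
  | nec _ h => exact .nec h

theorem boxLogic_thm : BoxLogic {axFour0} {φ | Thm φ} where
  ipc _ h := .ipc h
  norm_and := .box_and _ _
  norm_top := .box_top
  ax := by
    rintro _ rfl
    exact .four _
  subst _ h σ := thm_subst h σ
  mp _ _ h₁ h₂ := .mp h₁ h₂
  nec _ h := .nec h

theorem mem_smallestBoxLogic_iff {φ : Fml0} : φ ∈ smallestBoxLogic {axFour0} ↔ Thm φ := by
  refine ⟨fun h => h _ boxLogic_thm, fun h L hL => ?_⟩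
  induction h with
  | ipc h => exact hL.ipc _ h
  | box_and φ ψ => exact hL.subst _ hL.norm_and fun n => if n = 0 then φ else ψ
  | box_top => exact hL.norm_top
  | four φ => exact hL.subst _ (hL.ax rfl) fun _ => φ
  | mp _ _ h₁ h₂ => exact hL.mp _ _ h₁ h₂
  | nec _ h => exact hL.nec _ h

/-- Sets of formulas containing iK4 and closed under modus ponens. -/
structure Theory (T : Set Fml0) : Prop where
  thm : ∀ {φ : Fml0}, Thm φ → φ ∈ T
  mp : ∀ {φ ψ : Fml0}, φ.imp ψ ∈ T → φ ∈ T → ψ ∈ T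

namespace Theory

variable {T : Set Fml0} {φ ψ χ : Fml0}

theorem weaken (hT : Theory T) (h : φ ∈ T) : ψ.imp φ ∈ T := hT.mp (hT.thm (.ipc (.ax1 _ _))) h

theorem adjoin (hT : Theory T) (φ : Fml0) : Theory {ψ | φ.imp ψ ∈ T} where
  thm h := hT.weaken (hT.thm h)
  mp h₁ h₂ := hT.mp (hT.mp (hT.thm (.ipc (.ax2 _ _ _))) h₁) h₂

theorem imp_self (hT : Theory T) (φ : Fml0) : φ.imp φ ∈ T :=
  hT.mp (hT.mp (hT.thm (.ipc (.ax2 _ (φ.imp φ) _))) (hT.thm (.ipc (.ax1 _ _))))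
    (hT.thm (.ipc (.ax1 _ _)))

theorem imp_trans (hT : Theory T) (h₁ : φ.imp ψ ∈ T) (h₂ : ψ.imp χ ∈ T) : φ.imp χ ∈ T :=
  (hT.adjoin φ).mp (hT.weaken h₂) h₁

theorem and_mem_iff (hT : Theory T) : φ.and ψ ∈ T ↔ φ ∈ T ∧ ψ ∈ T :=
  ⟨fun h => ⟨hT.mp (hT.thm (.ipc (.andE1 _ _))) h, hT.mp (hT.thm (.ipc (.andE2 _ _))) h⟩,
    fun h => hT.mp (hT.mp (hT.thm (.ipc (.andI _ _))) h.1) h.2⟩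

theorem or_elim (hT : Theory T) (h : φ.or ψ ∈ T) (h₁ : φ.imp χ ∈ T) (h₂ : ψ.imp χ ∈ T) : χ ∈ T :=
  hT.mp (hT.mp (hT.mp (hT.thm (.ipc (.orE _ _ _))) h₁) h₂) h

theorem box_and_mem_iff (hT : Theory T) : (φ.and ψ).box ∈ T ↔ φ.box ∈ T ∧ ψ.box ∈ T := by
  have h := hT.and_mem_iff.1 (hT.thm (.box_and φ ψ))
  rw [← hT.and_mem_iff]
  exact ⟨hT.mp h.1, hT.mp h.2⟩

end Theory

theorem theory_thm : Theory {φ | Thm φ} := ⟨id, Thm.mp⟩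

/-- Consistent theories with the disjunction property. -/
structure PrimeTheory (T : Set Fml0) : Prop extends Theory T where
  bot_notMem : bot ∉ T
  or_mem : ∀ {φ ψ : Fml0}, φ.or ψ ∈ T → φ ∈ T ∨ ψ ∈ T

theorem exists_primeTheory {T D : Set Fml0} (hT : Theory T) (hne : D.Nonempty)
    (hdir : ∀ φ ∈ D, ∀ ψ ∈ D, ∃ χ ∈ D, Thm (φ.imp χ) ∧ Thm (ψ.imp χ))
    (hdisj : Disjoint T D) : ∃ P, PrimeTheory P ∧ T ⊆ P ∧ Disjoint P D := by
  obtain ⟨P, hTP, hP⟩ := zorn_subset_nonempty {S | Theory S ∧ Disjoint S D}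
    (fun c hc hchain hcne => by
      refine ⟨⋃₀ c, ⟨⟨fun h => ?_, fun h₁ h₂ => ?_⟩, ?_⟩, fun s hs => Set.subset_sUnion_of_mem hs⟩
      · obtain ⟨s, hs⟩ := hcne
        exact ⟨s, hs, (hc hs).1.thm h⟩
      · obtain ⟨s, hs, h₁⟩ := h₁
        obtain ⟨t, ht, h₂⟩ := h₂
        obtain h | h := hchain.total hs ht
        · exact ⟨t, ht, (hc ht).1.mp (h h₁) h₂⟩
        · exact ⟨s, hs, (hc hs).1.mp h₁ (h h₂)⟩
      · exact Set.disjoint_sUnion_left.2 fun s hs => (hc hs).2) T ⟨hT, hdisj⟩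
  obtain ⟨hth, hPD⟩ := hP.prop
  have key : ∀ φ, φ ∉ P → ∃ d ∈ D, φ.imp d ∈ P := by
    intro φ hφ
    by_contra! hcon
    refine hφ (hP.le_of_ge (y := {ψ | φ.imp ψ ∈ P}) ⟨hth.adjoin φ, ?_⟩ ?_ (hth.imp_self φ))
    · exact Set.disjoint_left.2 fun d h hd => hcon d hd h
    · exact fun ψ h => hth.weaken h
  refine ⟨P, { hth with bot_notMem := fun h => ?_, or_mem := fun {φ ψ} h => ?_ }, hTP, hPD⟩
  · obtain ⟨d, hd⟩ := hne
    exact Set.disjoint_left.1 hPD (hth.mp (hth.thm (.ipc (.botE d))) h) hd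
  · by_contra! hcon
    obtain ⟨d, hd, h₁⟩ := key φ hcon.1
    obtain ⟨e, he, h₂⟩ := key ψ hcon.2
    obtain ⟨f, hf, h₃, h₄⟩ := hdir d hd e he
    exact Set.disjoint_left.1 hPD
      (hth.or_elim h (hth.imp_trans h₁ (hth.thm h₃)) (hth.imp_trans h₂ (hth.thm h₄))) hf

theorem exists_primeTheory_notMem {T : Set Fml0} (hT : Theory T) {ψ : Fml0} (h : ψ ∉ T) :
    ∃ P, PrimeTheory P ∧ T ⊆ P ∧ ψ ∉ P := by
  obtain ⟨P, hP, hTP, hd⟩ := exists_primeTheory hT (Set.singleton_nonempty ψ)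
    (by
      rintro _ rfl _ rfl
      exact ⟨_, rfl, theory_thm.imp_self _, theory_thm.imp_self _⟩)
    (Set.disjoint_singleton_right.2 h)
  exact ⟨P, hP, hTP, Set.disjoint_singleton_right.1 hd⟩

theorem exists_primeTheory_agree {T P : Set Fml0} (hT : Theory T) (hP : PrimeTheory P) (V : Set ℕ)
    (h : ∀ φ ∈ T, φ.vars ⊆ V → φ ∈ P) :
    ∃ Q, PrimeTheory Q ∧ T ⊆ Q ∧ ∀ φ : Fml0, φ.vars ⊆ V → (φ ∈ Q ↔ φ ∈ P) := by
  have hS : Theory {ψ | ∃ φ ∈ P, φ.vars ⊆ V ∧ φ.imp ψ ∈ T} := by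
    refine ⟨fun h => ⟨top, hP.thm (.ipc .topI), Set.empty_subset _, hT.weaken (hT.thm h)⟩, ?_⟩
    rintro φ ψ ⟨a, ha, haV, h₁⟩ ⟨b, hb, hbV, h₂⟩
    refine ⟨a.and b, hP.and_mem_iff.2 ⟨ha, hb⟩, Set.union_subset haV hbV, ?_⟩
    exact (hT.adjoin _).mp (hT.imp_trans (hT.thm (.ipc (.andE1 _ _))) h₁)
      (hT.imp_trans (hT.thm (.ipc (.andE2 _ _))) h₂)
  obtain ⟨Q, hQ, hSQ, hd⟩ := exists_primeTheory (D := {φ | φ.vars ⊆ V ∧ φ ∉ P}) hS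
    ⟨bot, Set.empty_subset _, hP.bot_notMem⟩
    (fun φ hφ ψ hψ => ⟨φ.or ψ, ⟨Set.union_subset hφ.1 hψ.1,
      fun h => (hP.or_mem h).elim hφ.2 hψ.2⟩, .ipc (.orI1 _ _), .ipc (.orI2 _ _)⟩)
    (Set.disjoint_left.2 (by
      rintro ψ ⟨φ, hφ, hφV, h₁⟩ ⟨hψV, hψ⟩
      exact hψ (hP.mp (h _ h₁ (Set.union_subset hφV hψV)) hφ)))
  refine ⟨Q, hQ, fun φ hφ => hSQ ?_, fun φ hφ => ⟨fun h => ?_, fun h => hSQ ?_⟩⟩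
  · exact ⟨top, hP.thm (.ipc .topI), Set.empty_subset _, hT.weaken hφ⟩
  · by_contra hn
    exact Set.disjoint_left.1 hd h ⟨hφ, hn⟩
  · exact ⟨φ, h, hφ, hT.imp_self φ⟩

/-- Pairs of prime theories agreeing on the formulas in the common variables. -/
structure World (V : Bool → Set ℕ) where
  /-- The two theories. -/
  th : Bool → Set Fml0
  prime : ∀ i, PrimeTheory (th i)
  agree : ∀ (i j : Bool) (φ : Fml0), φ.vars ⊆ V i → φ.vars ⊆ V j → (φ ∈ th i ↔ φ ∈ th j)

variable {V : Bool → Set ℕ}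

/-- Valuation of formulas regarded as atoms; an atom in the variables of neither side holds. -/
def World.Atom (w : World V) (φ : Fml0) : Prop := ∀ i, φ.vars ⊆ V i → φ ∈ w.th i

/-- Valuation of boxed formulas, distributing over conjunctions. -/
def World.Box (w : World V) : Fml0 → Prop
  | .and φ ψ => w.Box φ ∧ w.Box ψ
  | φ => w.Atom φ.box

/-- Intuitionistic forcing over pairs of theories, with boxed formulas evaluated by `World.Box`. -/
def World.Forces (w : World V) : Fml0 → Prop
  | .var n => w.Atom (.var n)
  | .top => True
  | .bot => False
  | .and φ ψ => w.Forces φ ∧ w.Forces ψ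
  | .or φ ψ => w.Forces φ ∨ w.Forces ψ
  | .imp φ ψ => ∀ v : World V, (∀ i, w.th i ⊆ v.th i) → v.Forces φ → v.Forces ψ
  | .box φ => w.Box φ

namespace World

theorem atom_iff (w : World V) {i : Bool} {φ : Fml0} (h : φ.vars ⊆ V i) :
    w.Atom φ ↔ φ ∈ w.th i :=
  ⟨fun ha => ha i h, fun hm j hj => (w.agree i j φ h hj).1 hm⟩

theorem box_iff (w : World V) {i : Bool} {φ : Fml0} (h : φ.vars ⊆ V i) :
    w.Box φ ↔ φ.box ∈ w.th i := by
  induction φ with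
  | and φ ψ h₁ h₂ =>
    rw [(w.prime i).box_and_mem_iff, ← h₁ (Set.union_subset_iff.1 h).1,
      ← h₂ (Set.union_subset_iff.1 h).2]
    rfl
  | _ => exact w.atom_iff (φ := Fml0.box _) h

theorem box_of_thm (w : World V) {φ : Fml0} (h : Thm φ) : w.Box φ := by
  induction φ with
  | and φ ψ h₁ h₂ =>
    exact ⟨h₁ (theory_thm.and_mem_iff.1 h).1, h₂ (theory_thm.and_mem_iff.1 h).2⟩
  | _ => exact fun i _ => (w.prime i).thm h.nec

theorem Box.mono {w v : World V} (hwv : ∀ i, w.th i ⊆ v.th i) {φ : Fml0} (h : w.Box φ) :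
    v.Box φ := by
  induction φ with
  | and φ ψ h₁ h₂ => exact ⟨h₁ h.1, h₂ h.2⟩
  | _ => exact fun i hi => hwv i (h i hi)

theorem Forces.mono {w v : World V} (hwv : ∀ i, w.th i ⊆ v.th i) {φ : Fml0} (h : w.Forces φ) :
    v.Forces φ := by
  induction φ with
  | var => exact fun i hi => hwv i (h i hi)
  | top => trivial
  | bot => exact h
  | and φ ψ h₁ h₂ => exact ⟨h₁ h.1, h₂ h.2⟩
  | or φ ψ h₁ h₂ => exact Or.imp h₁ h₂ h
  | imp φ ψ => exact fun u hu => h u fun i => (hwv i).trans (hu i)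
  | box => exact Box.mono hwv h

theorem forces_of_ipc {φ : Fml0} (h : IPC0 φ) (w : World V) : w.Forces φ := by
  induction h generalizing w with
  | ax1 => exact fun v _ h u hu _ => h.mono hu
  | ax2 =>
    exact fun v _ h u hu h' t ht ha =>
      h t (fun i => (hu i).trans (ht i)) ha t (fun _ => subset_rfl) (h' t ht ha)
  | andE1 => exact fun _ _ h => h.1
  | andE2 => exact fun _ _ h => h.2
  | andI => exact fun v _ h u hu h' => ⟨h.mono hu, h'⟩
  | orI1 => exact fun _ _ h => Or.inl h
  | orI2 => exact fun _ _ h => Or.inr h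
  | orE =>
    exact fun v _ h u hu h' t ht ho =>
      ho.elim (h t fun i => (hu i).trans (ht i)) (h' t ht)
  | botE => exact fun _ _ h => h.elim
  | topI => trivial
  | mp _ _ _ _ h₁ h₂ => exact h₁ w w (fun _ => subset_rfl) (h₂ w)

theorem forces_of_thm {φ : Fml0} (h : Thm φ) (w : World V) : w.Forces φ := by
  induction h generalizing w with
  | ipc h => exact forces_of_ipc h w
  | box_and φ ψ => exact ⟨fun _ _ h => h, fun _ _ h => h⟩
  | box_top => exact w.box_of_thm (.ipc .topI)
  | four φ =>
    exact fun v _ h i hi => (v.prime i).mp ((v.prime i).thm (.four φ)) ((v.box_iff (φ := φ) hi).1 h)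
  | mp _ _ h₁ h₂ => exact h₁ w w (fun _ => subset_rfl) (h₂ w)
  | nec h => exact w.box_of_thm h

/-- A prime theory on side `i` and a theory on the other side, containing no more common formulas,
are realized in a single world. -/
theorem exists_of_primeTheory {P T : Set Fml0} (i : Bool) (hP : PrimeTheory P) (hT : Theory T)
    (h : ∀ φ ∈ T, φ.vars ⊆ V i ∩ V !i → φ ∈ P) :
    ∃ w : World V, w.th i = P ∧ T ⊆ w.th !i := by
  obtain ⟨Q, hQ, hTQ, hag⟩ := exists_primeTheory_agree hT hP _ h
  refine ⟨⟨fun j => if j = i then P else Q, fun j => ?_, fun j k φ hj hk => ?_⟩, ?_, ?_⟩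
  · split_ifs
    exacts [hP, hQ]
  · have := hag φ
    cases i <;> cases j <;> cases k <;> simp_all
  · simp
  · simpa using hTQ

theorem exists_extension (w : World V) (i : Bool) {P : Set Fml0} (hP : PrimeTheory P)
    (h : w.th i ⊆ P) : ∃ v : World V, (∀ j, w.th j ⊆ v.th j) ∧ v.th i = P := by
  obtain ⟨v, h₁, h₂⟩ := exists_of_primeTheory (V := V) i hP (w.prime !i).toTheory
    fun φ hφ hV => h ((w.agree _ _ φ (hV.trans Set.inter_subset_left)
      (hV.trans Set.inter_subset_right)).2 hφ)
  refine ⟨v, fun j => ?_, h₁⟩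
  obtain rfl | rfl : j = i ∨ j = !i := by cases i <;> cases j <;> simp
  · rwa [h₁]
  · exact h₂

theorem forces_iff (w : World V) {i : Bool} {φ : Fml0} (h : φ.vars ⊆ V i) :
    w.Forces φ ↔ φ ∈ w.th i := by
  induction φ generalizing w with
  | var => exact w.atom_iff h
  | top => exact iff_of_true trivial ((w.prime i).thm (.ipc .topI))
  | bot => exact iff_of_false id (w.prime i).bot_notMem
  | and φ ψ h₁ h₂ =>
    obtain ⟨hφ, hψ⟩ := Set.union_subset_iff.1 h
    rw [(w.prime i).and_mem_iff, ← h₁ w hφ, ← h₂ w hψ]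
    rfl
  | or φ ψ h₁ h₂ =>
    obtain ⟨hφ, hψ⟩ := Set.union_subset_iff.1 h
    have hw := w.prime i
    refine (or_congr (h₁ w hφ) (h₂ w hψ)).trans ⟨fun h => ?_, hw.or_mem⟩
    exact h.elim (hw.mp (hw.thm (.ipc (.orI1 _ _)))) (hw.mp (hw.thm (.ipc (.orI2 _ _))))
  | imp φ ψ h₁ h₂ =>
    obtain ⟨hφ, hψ⟩ := Set.union_subset_iff.1 h
    refine ⟨fun hf => ?_, fun hm v hv hf => ?_⟩
    · by_contra hn
      obtain ⟨P, hP, hwP, hψP⟩ := exists_primeTheory_notMem ((w.prime i).adjoin φ) hn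
      obtain ⟨v, hwv, rfl⟩ := w.exists_extension i hP fun χ hχ => hwP ((w.prime i).weaken hχ)
      exact hψP ((h₂ v hψ).1 (hf v hwv ((h₁ v hφ).2 (hwP ((w.prime i).imp_self φ)))))
    · exact (h₂ v hψ).2 ((v.prime i).mp (hv i hm) ((h₁ v hφ).1 hf))
  | box => exact w.box_iff h

end World

theorem exists_interpolant {φ ψ : Fml0} (h : Thm (φ.imp ψ)) :
    ∃ χ : Fml0, χ.vars ⊆ φ.vars ∩ ψ.vars ∧ Thm (φ.imp χ) ∧ Thm (χ.imp ψ) := by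
  by_contra! hcon
  have hS : Theory {β | ∃ χ : Fml0, χ.vars ⊆ φ.vars ∩ ψ.vars ∧ Thm (φ.imp χ) ∧
      Thm (χ.imp β)} := by
    refine ⟨fun h => ⟨top, Set.empty_subset _, theory_thm.weaken (.ipc .topI),
      theory_thm.weaken h⟩, ?_⟩
    rintro β γ ⟨a, haV, ha, h₁⟩ ⟨b, hbV, hb, h₂⟩
    refine ⟨a.and b, Set.union_subset haV hbV, (theory_thm.adjoin φ).and_mem_iff.2 ⟨ha, hb⟩, ?_⟩
    exact (theory_thm.adjoin _).mp (theory_thm.imp_trans (.ipc (.andE1 _ _)) h₁)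
      (theory_thm.imp_trans (.ipc (.andE2 _ _)) h₂)
  obtain ⟨P, hP, hSP, hψ⟩ := exists_primeTheory_notMem hS (ψ := ψ)
    fun ⟨χ, hV, h₁, h₂⟩ => hcon χ hV h₁ h₂
  obtain ⟨w, rfl, hw⟩ := World.exists_of_primeTheory
    (V := fun i => if i then ψ.vars else φ.vars) true hP (theory_thm.adjoin φ)
    fun χ hχ hV => hSP ⟨χ, by simpa [and_comm] using hV, hχ, theory_thm.imp_self χ⟩
  have hφ : w.Forces φ := (w.forces_iff (i := false) (by simp)).2 (hw (theory_thm.imp_self φ))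
  exact hψ ((w.forces_iff (by simp)).1 (World.forces_of_thm h w w (fun _ => subset_rfl) hφ))

end IK4Interpolation

/-- the logic iK4 = iK ⊕ (□p → □□p) has the Craig interpolation
property. -/
theorem iK4_CIP : CIP0 (smallestBoxLogic {axFour0}) := by
  intro φ ψ h
  simp only [IK4Interpolation.mem_smallestBoxLogic_iff] at h ⊢
  exact IK4Interpolation.exists_interpolant h
end
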